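/- arXiv:1910.00240 — 2 statements merged into one kernel-verified Lean document; each statement's English description precedes it below -/
import Mathlib

section
/- Let K ⊆ ℝ² be a triangulated 2-disk transverse to the verticals with roof T, and let f : ∂K → ℝ² be a vertical simplexwise-linear embedding (each vertex moves along its vertical line) with convex image. If σ is an f-obstructive spanning edge of K with one endpoint in T ∖ ∂T, then the other endpoint of σ also lies in T. -/
/-! Basic notions for triangulated 2-disks with straight simplices in the plane. -/

/-- Vertex set of an ordered triangle. -/
def vset {ι : Type} [DecidableEq ι] (t : ι × ι × ι) : Finset ι := {t.1, t.2.1, t.2.2}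

/-- The geometric (closed, filled) triangle spanned by an ordered triple of vertices. -/
def triSet {ι : Type} (pos : ι → ℝ × ℝ) (t : ι × ι × ι) : Set (ℝ × ℝ) :=
  convexHull ℝ {pos t.1, pos t.2.1, pos t.2.2}

/-- A triangulated 2-disk with straight (affine) simplices in the plane: finitely many
nondegenerate affine triangles, any two of which intersect exactly in the convex hull of
their common vertices, whose union is homeomorphic to the closed 2-disk. -/
structure TriDisk (ι : Type) [Fintype ι] [DecidableEq ι] where
  pos : ι → ℝ × ℝ
  inj : Function.Injective pos
  tris : Finset (ι × ι × ι)
  nonempty : tris.Nonempty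
  indep : ∀ t ∈ tris, AffineIndependent ℝ ![pos t.1, pos t.2.1, pos t.2.2]
  glue : ∀ s ∈ tris, ∀ t ∈ tris,
    triSet pos s ∩ triSet pos t = convexHull ℝ (pos '' ((vset s ∩ vset t : Finset ι) : Set ι))
  disk : Nonempty ((⋃ t ∈ tris, triSet pos t) ≃ₜ
      (Metric.closedBall (0 : EuclideanSpace ℝ (Fin 2)) 1))

namespace TriDisk

variable {ι : Type} [Fintype ι] [DecidableEq ι]

/-- The underlying space of the triangulated disk. -/
def space (D : TriDisk ι) : Set (ℝ × ℝ) := ⋃ t ∈ D.tris, triSet D.pos t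

/-- `a b` span an edge (1-simplex) of the triangulation. -/
def IsEdge (D : TriDisk ι) (a b : ι) : Prop :=
  a ≠ b ∧ ∃ t ∈ D.tris, a ∈ vset t ∧ b ∈ vset t

/-- A spanning edge: both endpoints on the boundary circle, open edge in the interior. -/
def IsSpanningEdge (D : TriDisk ι) (a b : ι) : Prop :=
  D.IsEdge a b ∧ D.pos a ∈ frontier D.space ∧ D.pos b ∈ frontier D.space ∧
    openSegment ℝ (D.pos a) (D.pos b) ⊆ interior D.space

/-- `K` is simple if it has no spanning edge. -/
def Simple (D : TriDisk ι) : Prop := ∀ a b : ι, ¬ D.IsSpanningEdge a b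

/-- Transverse to the verticals: every intersection with a vertical line is connected. -/
def TrV (D : TriDisk ι) : Prop :=
  ∀ c : ℝ, IsPreconnected (D.space ∩ {p : ℝ × ℝ | p.1 = c})

/-- A boundary edge of the triangulation. -/
def IsBoundaryEdge (D : TriDisk ι) (a b : ι) : Prop :=
  D.IsEdge a b ∧ segment ℝ (D.pos a) (D.pos b) ⊆ frontier D.space

/-- A roof edge: a boundary edge no ascending vertical ray from which meets the interior. -/
def IsRoofEdge (D : TriDisk ι) (a b : ι) : Prop :=
  D.IsBoundaryEdge a b ∧
    ∀ p ∈ segment ℝ (D.pos a) (D.pos b), ∀ s : ℝ, 0 ≤ s →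
      (p.1, p.2 + s) ∉ interior D.space

/-- The roof of a TrV disk, as a subset of the boundary. -/
def roof (D : TriDisk ι) : Set (ℝ × ℝ) :=
  ⋃ (a : ι) (b : ι) (_ : D.IsRoofEdge a b), segment ℝ (D.pos a) (D.pos b)

/-- `F` is simplexwise linear on the boundary of `D`. -/
def SLOnBoundary (D : TriDisk ι) (F : ℝ × ℝ → ℝ × ℝ) : Prop :=
  ∀ a b : ι, D.IsBoundaryEdge a b →
    ∃ g : (ℝ × ℝ) →ᵃ[ℝ] (ℝ × ℝ), Set.EqOn F g (segment ℝ (D.pos a) (D.pos b))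

/-- `F` is simplexwise linear on the whole disk `D`. -/
def SLOn (D : TriDisk ι) (F : ℝ × ℝ → ℝ × ℝ) : Prop :=
  ∀ t ∈ D.tris, ∃ g : (ℝ × ℝ) →ᵃ[ℝ] (ℝ × ℝ), Set.EqOn F g (triSet D.pos t)

/-- `F` is vertical on `S`: it preserves first coordinates there. -/
def VerticalOn (F : ℝ × ℝ → ℝ × ℝ) (S : Set (ℝ × ℝ)) : Prop :=
  ∀ p ∈ S, (F p).1 = p.1

/-- The image of the boundary under `F` is a convex polygon, i.e. it is the boundary
of a compact convex set with nonempty interior. -/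
def ConvexImage (D : TriDisk ι) (F : ℝ × ℝ → ℝ × ℝ) : Prop :=
  ∃ C : Set (ℝ × ℝ), Convex ℝ C ∧ IsCompact C ∧ (interior C).Nonempty ∧
    F '' frontier D.space = frontier C

/-- A spanning edge `{a,b}` is `F`-obstructive: `F` maps (the closure of) one of the two
arcs of the boundary circle determined by its endpoints into a straight line. -/
def Obstructive (D : TriDisk ι) (F : ℝ × ℝ → ℝ × ℝ) (a b : ι) : Prop :=
  D.IsSpanningEdge a b ∧ ∃ x ∈ frontier D.space \ {D.pos a, D.pos b},
    Collinear ℝ (F '' closure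
      (connectedComponentIn (frontier D.space \ {D.pos a, D.pos b}) x))

end TriDisk


open Set

namespace RoofPf

structure Reg (K : Set (ℝ × ℝ)) (m M : ℝ) (l u : ℝ → ℝ) : Prop where
  lt : m < M
  closed : IsClosed K
  mem : ∀ x y, (x, y) ∈ K ↔ (m ≤ x ∧ x ≤ M) ∧ l x ≤ y ∧ y ≤ u x
  int : ∀ x y, (x, y) ∈ interior K ↔ (m < x ∧ x < M) ∧ l x < y ∧ y < u x
  ltl : ∀ x, m < x → x < M → l x < u x
  lem : l m ≤ u m
  leM : l M ≤ u M
  reg : K ⊆ closure (interior K)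

noncomputable def hY : (ℝ × ℝ) ≃ₜ (ℝ × ℝ) := (Homeomorph.refl ℝ).prodCongr (Homeomorph.neg ℝ)
noncomputable def hX : (ℝ × ℝ) ≃ₜ (ℝ × ℝ) := (Homeomorph.neg ℝ).prodCongr (Homeomorph.refl ℝ)

@[simp] lemma hY_apply (x y : ℝ) : hY (x, y) = (x, -y) := rfl
@[simp] lemma hX_apply (x y : ℝ) : hX (x, y) = (-x, y) := rfl

variable {K : Set (ℝ × ℝ)} {m M : ℝ} {l u : ℝ → ℝ}

lemma Reg.flipY (h : Reg K m M l u) : Reg (hY ⁻¹' K) m M (fun x => - u x) (fun x => - l x) where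
  lt := h.lt
  closed := h.closed.preimage hY.continuous
  mem x y := by
    rw [mem_preimage, hY_apply, h.mem]
    constructor <;> rintro ⟨h1, h2, h3⟩ <;> refine ⟨h1, ?_, ?_⟩ <;> linarith
  int x y := by
    rw [← hY.preimage_interior, mem_preimage, hY_apply, h.int]
    constructor <;> rintro ⟨h1, h2, h3⟩ <;> refine ⟨h1, ?_, ?_⟩ <;> linarith
  ltl x h1 h2 := by have := h.ltl x h1 h2; linarith
  lem := by have := h.lem; linarith
  leM := by have := h.leM; linarith
  reg := by
    rw [← hY.preimage_interior, ← hY.preimage_closure]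
    exact preimage_mono h.reg

lemma Reg.flipX (h : Reg K m M l u) :
    Reg (hX ⁻¹' K) (-M) (-m) (fun x => l (-x)) (fun x => u (-x)) where
  lt := by have := h.lt; linarith
  closed := h.closed.preimage hX.continuous
  mem x y := by
    rw [mem_preimage, hX_apply, h.mem]
    constructor <;> rintro ⟨⟨h0, h1⟩, h2, h3⟩ <;> refine ⟨⟨?_, ?_⟩, ?_, ?_⟩ <;> linarith
  int x y := by
    rw [← hX.preimage_interior, mem_preimage, hX_apply, h.int]
    constructor <;> rintro ⟨⟨h0, h1⟩, h2, h3⟩ <;> refine ⟨⟨?_, ?_⟩, ?_, ?_⟩ <;> linarith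
  ltl x h1 h2 := h.ltl (-x) (by linarith) (by linarith)
  lem := by have := h.leM; simpa using this
  leM := by have := h.lem; simpa using this
  reg := by
    rw [← hX.preimage_interior, ← hX.preimage_closure]
    exact preimage_mono h.reg

lemma Reg.fr (h : Reg K m M l u) (x y : ℝ) : (x, y) ∈ frontier K ↔
    ((m < x ∧ x < M) ∧ (y = l x ∨ y = u x)) ∨
      ((x = m ∨ x = M) ∧ l x ≤ y ∧ y ≤ u x) := by
  rw [h.closed.frontier_eq, mem_sdiff, h.mem, h.int]
  have := h.lt
  constructor
  · rintro ⟨⟨⟨h1, h2⟩, h3, h4⟩, h5⟩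
    rcases h1.eq_or_lt with h1 | h1
    · exact Or.inr ⟨Or.inl h1.symm, h3, h4⟩
    rcases h2.eq_or_lt with h2 | h2
    · exact Or.inr ⟨Or.inr h2, h3, h4⟩
    left
    refine ⟨⟨h1, h2⟩, ?_⟩
    by_contra! hc
    exact h5 ⟨⟨h1, h2⟩, lt_of_le_of_ne h3 (Ne.symm hc.1), lt_of_le_of_ne h4 hc.2⟩
  · rintro (⟨⟨h1, h2⟩, h3⟩ | ⟨h1, h2, h3⟩)
    · have := h.ltl x h1 h2
      refine ⟨⟨⟨h1.le, h2.le⟩, ?_, ?_⟩, ?_⟩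
      · rcases h3 with rfl | rfl <;> linarith
      · rcases h3 with rfl | rfl <;> linarith
      · rintro ⟨-, h4, h5⟩
        rcases h3 with rfl | rfl <;> linarith
    · refine ⟨⟨?_, h2, h3⟩, ?_⟩
      · rcases h1 with rfl | rfl <;> constructor <;> linarith
      · rintro ⟨⟨h4, h5⟩, -⟩
        rcases h1 with rfl | rfl <;> linarith

lemma vert_cont (c : ℝ) : Continuous (fun x : ℝ => (x, c)) := by fun_prop

lemma Reg.lcont (h : Reg K m M l u) : ContinuousOn l (Ioo m M) := by
  intro x0 hx0
  apply ContinuousAt.continuousWithinAt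
  have hlu := h.ltl x0 hx0.1 hx0.2
  have hint : ∀ y, l x0 < y → y < u x0 → ∀ᶠ x in nhds x0, (x, y) ∈ interior K := by
    intro y h1 h2
    exact (vert_cont y).continuousAt.eventually
      (isOpen_interior.mem_nhds ((h.int x0 y).2 ⟨hx0, h1, h2⟩))
  rw [ContinuousAt, tendsto_order]
  constructor
  · intro c hc
    obtain ⟨y, hy1, hy2⟩ := exists_between hlu
    have hn : (x0, c) ∉ K := fun hk => by have := ((h.mem _ _).1 hk).2.1; linarith
    have hn' : ∀ᶠ x in nhds x0, (x, c) ∈ Kᶜ :=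
      (vert_cont c).continuousAt.eventually (h.closed.isOpen_compl.mem_nhds hn)
    filter_upwards [hint y hy1 hy2, hn'] with x hx1 hx2
    obtain ⟨h3, h4, h5⟩ := (h.int _ _).1 hx1
    by_contra! hle
    exact hx2 ((h.mem _ _).2 ⟨⟨h3.1.le, h3.2.le⟩, hle, by linarith⟩)
  · intro c hc
    obtain ⟨y, hy1, hy2⟩ := exists_between (lt_min hc hlu)
    have := lt_min_iff.1 hy2
    filter_upwards [hint y hy1 this.2] with x hx1
    have := ((h.int _ _).1 hx1).2.1
    linarith

lemma Reg.ucont (h : Reg K m M l u) : ContinuousOn u (Ioo m M) := by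
  have := h.flipY.lcont.neg
  exact this.congr (fun x _ => (neg_neg _).symm)

def gr (l : ℝ → ℝ) (s : Set ℝ) : Set (ℝ × ℝ) := {p | p.1 ∈ s ∧ p.2 = l p.1}

lemma gr_eq (l : ℝ → ℝ) (s : Set ℝ) : gr l s = (fun x => (x, l x)) '' s := by
  ext ⟨x, y⟩
  simp only [gr, mem_ofPred_eq, mem_image, Prod.mk.injEq]
  constructor
  · rintro ⟨h1, h2⟩; exact ⟨x, h1, rfl, h2.symm⟩
  · rintro ⟨x', h1, rfl, h2⟩; exact ⟨h1, h2.symm⟩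

lemma gr_conn {s t : Set ℝ} (hl : ContinuousOn l t) (hst : s ⊆ t) (hs : IsPreconnected s) :
    IsPreconnected (gr l s) := by
  rw [gr_eq]
  exact hs.image _ (continuousOn_id.prodMk (hl.mono hst))

def vt (c : ℝ) (s : Set ℝ) : Set (ℝ × ℝ) := {p | p.1 = c ∧ p.2 ∈ s}

lemma vt_conn (c : ℝ) {s : Set ℝ} (hs : IsPreconnected s) : IsPreconnected (vt c s) := by
  have : vt c s = (fun y => (c, y)) '' s := by
    ext ⟨x, y⟩
    simp only [vt, mem_ofPred_eq, mem_image, Prod.mk.injEq]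
    constructor
    · rintro ⟨h1, h2⟩; exact ⟨y, h2, h1.symm, rfl⟩
    · rintro ⟨x', h1, h3, rfl⟩; exact ⟨h3.symm, h1⟩
  rw [this]
  exact hs.image _ (by fun_prop)

lemma Reg.clm (h : Reg K m M l u) {c : ℝ} (hc : m < c) : (m, l m) ∈ closure (gr l (Ioo m c)) := by
  rw [Metric.mem_closure_iff]
  intro ε hε
  have hK : (m, l m) ∈ K := (h.mem _ _).2 ⟨⟨le_rfl, h.lt.le⟩, le_rfl, h.lem⟩
  have hn : (m, l m - ε / 2) ∉ K := fun hk => by have := ((h.mem _ _).1 hk).2.1; linarith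
  have hn' : ∀ᶠ x in nhds m, (x, l m - ε / 2) ∈ Kᶜ :=
    (vert_cont _).continuousAt.eventually (h.closed.isOpen_compl.mem_nhds hn)
  obtain ⟨δ, hδ, hn''⟩ := Metric.eventually_nhds_iff.1 hn'
  have hpos : 0 < min (min δ (ε / 2)) (c - m) := by
    refine lt_min (lt_min hδ (by linarith)) (by linarith)
  obtain ⟨⟨x, y⟩, hi, hd⟩ := Metric.mem_closure_iff.1 (h.reg hK) _ hpos
  rw [lt_min_iff, lt_min_iff, Prod.dist_eq] at hd
  obtain ⟨⟨h1, h2⟩, h3⟩ := hd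
  rw [max_lt_iff, Real.dist_eq, Real.dist_eq, abs_lt, abs_lt] at h1 h2 h3
  simp only at h1 h2 h3
  obtain ⟨h4, h5, h6⟩ := (h.int _ _).1 hi
  have h7 := hn'' (y := x) (by rw [Real.dist_eq, abs_lt]; constructor <;> linarith)
  have h8 : l m - ε / 2 < l x := by
    by_contra! hle
    exact h7 ((h.mem _ _).2 ⟨⟨h4.1.le, h4.2.le⟩, hle, by linarith⟩)
  refine ⟨(x, l x), ⟨⟨h4.1, by simp only; linarith⟩, rfl⟩, ?_⟩
  rw [Prod.dist_eq, max_lt_iff, Real.dist_eq, Real.dist_eq, abs_lt, abs_lt]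
  refine ⟨⟨?_, ?_⟩, ?_, ?_⟩ <;> simp only <;> linarith

lemma Reg.cum (h : Reg K m M l u) {c : ℝ} (hc : m < c) : (m, u m) ∈ closure (gr u (Ioo m c)) := by
  have h1 := h.flipY.clm hc
  have h2 : gr (fun x => - u x) (Ioo m c) = hY ⁻¹' (gr u (Ioo m c)) := by
    ext ⟨x, y⟩
    simp [gr, neg_eq_iff_eq_neg]
  rw [h2, ← hY.preimage_closure] at h1
  simpa using h1

lemma gr_flipX (l : ℝ → ℝ) (c M : ℝ) :
    gr (fun x => l (-x)) (Ioo (-M) (-c)) = hX ⁻¹' (gr l (Ioo c M)) := by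
  ext ⟨x, y⟩
  simp only [gr, mem_ofPred_eq, mem_preimage, hX_apply, mem_Ioo]
  constructor <;> rintro ⟨⟨h1, h2⟩, h3⟩ <;> refine ⟨⟨?_, ?_⟩, h3⟩ <;> linarith

lemma Reg.clM (h : Reg K m M l u) {c : ℝ} (hc : c < M) : (M, l M) ∈ closure (gr l (Ioo c M)) := by
  have h1 := h.flipX.clm (neg_lt_neg hc)
  rw [gr_flipX, ← hX.preimage_closure] at h1
  simpa using h1

lemma Reg.cuM (h : Reg K m M l u) {c : ℝ} (hc : c < M) : (M, u M) ∈ closure (gr u (Ioo c M)) := by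
  have h1 := h.flipX.cum (neg_lt_neg hc)
  rw [gr_flipX, ← hX.preimage_closure] at h1
  simpa using h1

lemma conn_glue {S T : Set (ℝ × ℝ)} (hS : IsPreconnected S) (hT : IsPreconnected T)
    (p : ℝ × ℝ) (hp : p ∈ T) (hc : p ∈ closure S) : IsPreconnected (S ∪ T) := by
  have h1 : IsPreconnected (S ∪ {p}) := by
    refine hS.subset_closure subset_union_left ?_
    exact union_subset subset_closure (singleton_subset_iff.2 hc)
  have h2 := h1.union p (by simp) hp hT
  have : S ∪ {p} ∪ T = S ∪ T := by
    rw [union_assoc, singleton_union, insert_eq_of_mem hp]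
  rwa [this] at h2

def Bad (S : Set (ℝ × ℝ)) : Prop :=
  ∃ p ∈ S, ∃ q ∈ S, ∃ r ∈ S, p ≠ q ∧ p.1 = q.1 ∧ r.1 ≠ p.1

def Split (S : Set (ℝ × ℝ)) : Prop :=
  ∃ P Q : Set (ℝ × ℝ), IsPreconnected P ∧ IsPreconnected Q ∧ Bad P ∧ Bad Q ∧ P ∪ Q = S

lemma Bad.preX {S : Set (ℝ × ℝ)} (h : Bad (hX ⁻¹' S)) : Bad S := by
  obtain ⟨⟨p, p'⟩, hp, ⟨q, q'⟩, hq, ⟨r, r'⟩, hr, h1, h2, h3⟩ := h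
  refine ⟨_, hp, _, hq, _, hr, ?_, ?_, ?_⟩
  · exact fun h => h1 (hX.injective h)
  · simpa using h2
  · simpa using h3

lemma Split.preX {S : Set (ℝ × ℝ)} (h : Split (hX ⁻¹' S)) : Split S := by
  obtain ⟨P, Q, h1, h2, h3, h4, h5⟩ := h
  have key : ∀ R, hX ⁻¹' (hX '' R) = R := fun R => preimage_image_eq R hX.injective
  refine ⟨hX '' P, hX '' Q, h1.image _ hX.continuous.continuousOn,
    h2.image _ hX.continuous.continuousOn, ?_, ?_, ?_⟩
  · apply Bad.preX; rwa [key]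
  · apply Bad.preX; rwa [key]
  · rw [← image_union, h5, image_preimage_eq _ hX.surjective]

/-- left half: lower-left graph together with left side. -/
lemma Reg.connL (h : Reg K m M l u) {β : ℝ} (h1 : m < β) (h2 : β ≤ M) {s : Set ℝ}
    (hs : IsPreconnected s) (hm : l m ∈ s) :
    IsPreconnected (gr l (Ioo m β) ∪ vt m s) :=
  conn_glue (gr_conn h.lcont (Ioo_subset_Ioo le_rfl h2) isPreconnected_Ioo)
    (vt_conn m hs) (m, l m) ⟨rfl, hm⟩ (h.clm h1)

lemma Reg.connR (h : Reg K m M l u) {β : ℝ} (h1 : β < M) (h2 : m ≤ β) {s : Set ℝ}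
    (hs : IsPreconnected s) (hm : l M ∈ s) :
    IsPreconnected (gr l (Ioo β M) ∪ vt M s) :=
  conn_glue (gr_conn h.lcont (Ioo_subset_Ioo h2 le_rfl) isPreconnected_Ioo)
    (vt_conn M hs) (M, l M) ⟨rfl, hm⟩ (h.clM h1)

lemma Reg.split_mid (h : Reg K m M l u) {α β : ℝ} (hα : m < α ∧ α < M) (hβ : m < β ∧ β < M) :
    Split (frontier K \ {(α, u α), (β, l β)}) := by
  refine ⟨gr u (Ioo m α) ∪ (gr l (Ioo m β) ∪ vt m (Icc (l m) (u m))),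
    gr u (Ioo α M) ∪ (gr l (Ioo β M) ∪ vt M (Icc (l M) (u M))), ?_, ?_, ?_, ?_, ?_⟩
  · refine conn_glue (gr_conn h.ucont (Ioo_subset_Ioo le_rfl hα.2.le) isPreconnected_Ioo)
      (h.connL hβ.1 hβ.2.le isPreconnected_Icc (left_mem_Icc.2 h.lem)) (m, u m) ?_ (h.cum hα.1)
    exact Or.inr ⟨rfl, right_mem_Icc.2 h.lem⟩
  · refine conn_glue (gr_conn h.ucont (Ioo_subset_Ioo hα.1.le le_rfl) isPreconnected_Ioo)
      (h.connR hβ.2 hβ.1.le isPreconnected_Icc (left_mem_Icc.2 h.leM)) (M, u M) ?_ (h.cuM hα.2)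
    exact Or.inr ⟨rfl, right_mem_Icc.2 h.leM⟩
  · obtain ⟨x, hx1, hx2⟩ := exists_between (lt_min hα.1 hβ.1)
    obtain ⟨hx2, hx3⟩ := lt_min_iff.1 hx2
    have := h.ltl x hx1 (by linarith [hα.2])
    refine ⟨(x, u x), Or.inl ⟨⟨hx1, hx2⟩, rfl⟩, (x, l x), Or.inr (Or.inl ⟨⟨hx1, hx3⟩, rfl⟩),
      (m, l m), Or.inr (Or.inr ⟨rfl, left_mem_Icc.2 h.lem⟩), ?_, rfl, ?_⟩
    · intro he; rw [Prod.mk.injEq] at he; linarith [he.2]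
    · exact hx1.ne
  · obtain ⟨x, hx1, hx2⟩ := exists_between (max_lt hα.2 hβ.2)
    obtain ⟨hx1, hx3⟩ := max_lt_iff.1 hx1
    have := h.ltl x (by linarith [hα.1]) hx2
    refine ⟨(x, u x), Or.inl ⟨⟨hx1, hx2⟩, rfl⟩, (x, l x), Or.inr (Or.inl ⟨⟨hx3, hx2⟩, rfl⟩),
      (M, l M), Or.inr (Or.inr ⟨rfl, left_mem_Icc.2 h.leM⟩), ?_, rfl, ?_⟩
    · intro he; rw [Prod.mk.injEq] at he; linarith [he.2]
    · exact hx2.ne'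
  · ext ⟨x, y⟩
    have hlt := h.ltl x
    have hM := h.lt
    simp only [gr, vt, mem_union, mem_ofPred_eq, mem_sdiff, mem_insert_iff, mem_singleton_iff,
      Prod.mk.injEq, mem_Ioo, mem_Icc, h.fr]
    grind

lemma Reg.split_left (h : Reg K m M l u) {y β : ℝ} (hy : l m < y ∧ y ≤ u m)
    (hβ : m < β ∧ β < M) :
    Split (frontier K \ {(m, y), (β, l β)}) := by
  refine ⟨gr l (Ioo m β) ∪ vt m (Ico (l m) y),
    (gr u (Ioo m M) ∪ (gr l (Ioo β M) ∪ vt M (Icc (l M) (u M)))) ∪ vt m (Ioc y (u m)),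
    ?_, ?_, ?_, ?_, ?_⟩
  · exact h.connL hβ.1 hβ.2.le isPreconnected_Ico (left_mem_Ico.2 hy.1)
  · have h1 : IsPreconnected (gr u (Ioo m M) ∪ (gr l (Ioo β M) ∪ vt M (Icc (l M) (u M)))) := by
      refine conn_glue (gr_conn h.ucont le_rfl isPreconnected_Ioo)
        (h.connR hβ.2 hβ.1.le isPreconnected_Icc (left_mem_Icc.2 h.leM)) (M, u M) ?_ (h.cuM h.lt)
      exact Or.inr ⟨rfl, right_mem_Icc.2 h.leM⟩
    rcases hy.2.eq_or_lt with he | hlt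
    · have : vt m (Ioc y (u m)) = ∅ := by
        rw [he, Ioc_self]; ext; simp [vt]
      rwa [this, union_empty]
    · refine conn_glue h1 (vt_conn m isPreconnected_Ioc) (m, u m) ⟨rfl, right_mem_Ioc.2 hlt⟩ ?_
      exact closure_mono subset_union_left (h.cum h.lt)
  · obtain ⟨x, hx1, hx2⟩ := exists_between hβ.1
    obtain ⟨z, hz1, hz2⟩ := exists_between hy.1
    refine ⟨(m, l m), Or.inr ⟨rfl, left_mem_Ico.2 hy.1⟩, (m, z), Or.inr ⟨rfl, hz1.le, hz2⟩,
      (x, l x), Or.inl ⟨⟨hx1, hx2⟩, rfl⟩, ?_, rfl, hx1.ne'⟩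
    intro he; rw [Prod.mk.injEq] at he; linarith [he.2]
  · obtain ⟨x, hx1, hx2⟩ := exists_between hβ.2
    have := h.ltl x (by linarith [hβ.1]) hx2
    refine ⟨(x, u x), Or.inl (Or.inl ⟨⟨by linarith [hβ.1], hx2⟩, rfl⟩), (x, l x),
      Or.inl (Or.inr (Or.inl ⟨⟨hx1, hx2⟩, rfl⟩)),
      (M, l M), Or.inl (Or.inr (Or.inr ⟨rfl, left_mem_Icc.2 h.leM⟩)), ?_, rfl, ?_⟩
    · intro he; rw [Prod.mk.injEq] at he; linarith [he.2]
    · exact hx2.ne'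
  · ext ⟨x, z⟩
    have hlt := h.ltl x
    have hM := h.lt
    simp only [gr, vt, mem_union, mem_ofPred_eq, mem_sdiff, mem_insert_iff, mem_singleton_iff,
      Prod.mk.injEq, mem_Ioo, mem_Icc, mem_Ico, mem_Ioc, h.fr]
    grind

lemma Reg.split_right (h : Reg K m M l u) {y β : ℝ} (hy : l M < y ∧ y ≤ u M)
    (hβ : m < β ∧ β < M) :
    Split (frontier K \ {(M, y), (β, l β)}) := by
  apply Split.preX
  have := h.flipX.split_left (y := y) (β := -β) (by simpa using hy)
    ⟨by linarith [hβ.2], by linarith [hβ.1]⟩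
  convert this using 1
  rw [← hX.preimage_frontier]
  ext ⟨x, z⟩
  simp [neg_eq_iff_eq_neg]

lemma Reg.split (h : Reg K m M l u) {x y β : ℝ} (hf : (x, y) ∈ frontier K)
    (hβ : m < β ∧ β < M)
    (hu : m < x → x < M → y = u x) (h1 : x = m → l m < y) (h2 : x = M → l M < y) :
    Split (frontier K \ {(x, y), (β, l β)}) := by
  rcases (h.fr _ _).1 hf with ⟨h3, -⟩ | ⟨rfl | rfl, h3, h4⟩
  · rw [hu h3.1 h3.2]; exact h.split_mid h3 hβ
  · exact h.split_left ⟨h1 rfl, h4⟩ hβ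
  · exact h.split_right ⟨h2 rfl, h4⟩ hβ

lemma int_vert {K : Set (ℝ × ℝ)} {x y : ℝ} (h : (x, y) ∈ interior K) :
    ∃ ε > 0, (x, y - ε) ∈ K ∧ (x, y + ε) ∈ K ∧ (x - ε, y) ∈ K ∧ (x + ε, y) ∈ K := by
  rw [mem_interior_iff_mem_nhds, Metric.mem_nhds_iff] at h
  obtain ⟨ε, hε, h⟩ := h
  refine ⟨ε / 2, by linarith, h ?_, h ?_, h ?_, h ?_⟩ <;>
  · rw [Metric.mem_ball, Prod.dist_eq, max_lt_iff, Real.dist_eq, Real.dist_eq, abs_lt, abs_lt]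
    refine ⟨⟨?_, ?_⟩, ?_, ?_⟩ <;> simp only <;> linarith

lemma slice_Icc {K : Set (ℝ × ℝ)} (hK : IsCompact K) {x : ℝ}
    (hT : IsPreconnected (K ∩ {p : ℝ × ℝ | p.1 = x})) (hne : ∃ y, (x, y) ∈ K) :
    ∃ a b, a ≤ b ∧ ∀ y, (x, y) ∈ K ↔ a ≤ y ∧ y ≤ b := by
  have he : {y | (x, y) ∈ K} = Prod.snd '' (K ∩ {p : ℝ × ℝ | p.1 = x}) := by
    ext y
    constructor
    · intro h; exact ⟨(x, y), ⟨h, rfl⟩, rfl⟩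
    · rintro ⟨⟨x', y'⟩, ⟨h, rfl⟩, rfl⟩; exact h
  have h1 : IsCompact {y | (x, y) ∈ K} := by
    rw [he]
    exact (hK.inter_right (isClosed_eq continuous_fst continuous_const)).image continuous_snd
  have h2 : IsConnected {y | (x, y) ∈ K} := by
    refine ⟨hne, ?_⟩
    rw [he]
    exact hT.image _ continuous_snd.continuousOn
  have h3 := eq_Icc_of_connected_compact h2 h1
  refine ⟨_, _, ?_, fun y => by rw [← mem_Icc, ← h3]; rfl⟩
  obtain ⟨y, hy⟩ := hne
  have : y ∈ Icc (sInf {y | (x, y) ∈ K}) (sSup {y | (x, y) ∈ K}) := by rw [← h3]; exact hy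
  exact this.1.trans this.2

lemma convex_slices {C : Set (ℝ × ℝ)} (hC : Convex ℝ C) (hc : IsCompact C)
    (hi : (interior C).Nonempty) :
    ∃ m M, m < M ∧ (∀ p ∈ C, m ≤ p.1 ∧ p.1 ≤ M) ∧ (∃ p ∈ frontier C, p.1 = m) ∧
      (∃ p ∈ frontier C, p.1 = M) ∧
      ∀ x, m < x → x < M → ∃ y1 y2, y1 < y2 ∧ ∀ y, (x, y) ∈ frontier C ↔ y = y1 ∨ y = y2 := by
  obtain ⟨⟨z, z'⟩, hz⟩ := hi
  have hne : C.Nonempty := ⟨_, interior_subset hz⟩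
  obtain ⟨⟨m, pm⟩, hm, hm'⟩ := hc.exists_isMinOn hne continuous_fst.continuousOn
  obtain ⟨⟨M, pM⟩, hM, hM'⟩ := hc.exists_isMaxOn hne continuous_fst.continuousOn
  have hb : ∀ p ∈ C, m ≤ p.1 ∧ p.1 ≤ M := fun p hp => ⟨hm' hp, hM' hp⟩
  obtain ⟨ε, hε, -, -, hz1, hz2⟩ := int_vert hz
  have hz3 := hb _ hz1
  have hz4 := hb _ hz2
  simp only at hz3 hz4
  refine ⟨m, M, by linarith, hb, ⟨(m, pm), ?_, rfl⟩, ⟨(M, pM), ?_, rfl⟩, ?_⟩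
  · rw [hc.isClosed.frontier_eq]
    refine ⟨hm, fun h => ?_⟩
    obtain ⟨δ, hδ, -, -, h1, h2⟩ := int_vert h
    have := (hb _ h1).1
    simp only at this; linarith
  · rw [hc.isClosed.frontier_eq]
    refine ⟨hM, fun h => ?_⟩
    obtain ⟨δ, hδ, -, -, h1, h2⟩ := int_vert h
    have := (hb _ h2).2
    simp only at this; linarith
  · intro x hx1 hx2
    have hw : ∃ w, (x, w) ∈ interior C := by
      have key : ∀ c d : ℝ, (c, d) ∈ C → (∃ s : ℝ, 0 < s ∧ s ≤ 1 ∧ s * z + (1 - s) * c = x) →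
          ∃ w, (x, w) ∈ interior C := by
        rintro c d hcd ⟨s, hs0, hs1, hs⟩
        have := hC.combo_interior_self_mem_interior hz hcd hs0 (sub_nonneg.2 hs1) (by ring)
        refine ⟨s * z' + (1 - s) * d, ?_⟩
        simpa [hs] using this
      rcases le_total z x with h | h
      · refine key M pM hM ⟨(M - x) / (M - z), div_pos (by linarith) (by linarith), ?_, ?_⟩
        · rw [div_le_one (by linarith)]; linarith
        · have : M - z ≠ 0 := by linarith
          field_simp; ring
      · refine key m pm hm ⟨(x - m) / (z - m), div_pos (by linarith) (by linarith), ?_, ?_⟩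
        · rw [div_le_one (by linarith)]; linarith
        · have : z - m ≠ 0 := by linarith
          field_simp; ring
    obtain ⟨w, hw⟩ := hw
    have hconv : Convex ℝ (C ∩ {p : ℝ × ℝ | p.1 = x}) := by
      refine hC.inter ?_
      intro p hp q hq a b _ _ hab
      simp only [mem_ofPred_eq] at *
      simp [hp, hq, ← add_mul, hab]
    obtain ⟨y1, y2, h12, hy⟩ := slice_Icc hc hconv.isPreconnected ⟨w, interior_subset hw⟩
    obtain ⟨δ, hδ, h1, h2, -, -⟩ := int_vert hw
    have h1 := (hy _).1 h1
    have h2 := (hy _).1 h2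
    refine ⟨y1, y2, by linarith, fun y => ?_⟩
    rw [hc.isClosed.frontier_eq, mem_sdiff, hy]
    have key : ∀ e, (x, e) ∈ C → (∃ s : ℝ, 0 < s ∧ s ≤ 1 ∧ s * w + (1 - s) * e = y) →
          (x, y) ∈ interior C := by
      rintro e he ⟨s, hs0, hs1, hs⟩
      have := hC.combo_interior_self_mem_interior hw he hs0 (sub_nonneg.2 hs1) (by ring)
      have hx : s * x + (1 - s) * x = x := by ring
      simpa [hs, hx] using this
    constructor
    · rintro ⟨⟨h3, h4⟩, h5⟩
      by_contra! hne
      have h3 := lt_of_le_of_ne h3 (Ne.symm hne.1)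
      have h4 := lt_of_le_of_ne h4 hne.2
      apply h5
      rcases le_total w y with h | h
      · refine key y2 ((hy _).2 ⟨h12, le_rfl⟩) ⟨(y2 - y) / (y2 - w), div_pos (by linarith) (by linarith), ?_, ?_⟩
        · rw [div_le_one (by linarith)]; linarith
        · have : y2 - w ≠ 0 := by linarith
          field_simp; ring
      · refine key y1 ((hy _).2 ⟨le_rfl, h12⟩) ⟨(y - y1) / (w - y1), div_pos (by linarith) (by linarith), ?_, ?_⟩
        · rw [div_le_one (by linarith)]; linarith
        · have : w - y1 ≠ 0 := by linarith
          field_simp; ring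
    · intro h3
      refine ⟨by rcases h3 with rfl | rfl <;> constructor <;> linarith, fun h4 => ?_⟩
      obtain ⟨δ, hδ, h5, h6, -, -⟩ := int_vert h4
      have h5 := (hy _).1 h5
      have h6 := (hy _).1 h6
      rcases h3 with rfl | rfl <;> linarith

lemma exists_reg {K : Set (ℝ × ℝ)} (hK : IsCompact K) (hreg : K ⊆ closure (interior K))
    (hT : ∀ c : ℝ, IsPreconnected (K ∩ {p : ℝ × ℝ | p.1 = c}))
    (F : ℝ × ℝ → ℝ × ℝ) (hinj : Set.InjOn F (frontier K))
    (hvert : ∀ p ∈ frontier K, (F p).1 = p.1)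
    {C : Set (ℝ × ℝ)} (hC : Convex ℝ C) (hc : IsCompact C)
    (hi : (interior C).Nonempty) (hF : F '' frontier K = frontier C) :
    ∃ m M l u, Reg K m M l u := by
  obtain ⟨m, M, hmM, hb, hm, hM, hs⟩ := convex_slices hC hc hi
  have hfK : frontier K ⊆ K := hK.isClosed.frontier_subset
  have hfC : ∀ p ∈ frontier K, F p ∈ frontier C := fun p hp => hF ▸ mem_image_of_mem F hp
  have hback : ∀ x y, (x, y) ∈ frontier C → ∃ y', (x, y') ∈ frontier K ∧ F (x, y') = (x, y) := by
    intro x y h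
    rw [← hF] at h
    obtain ⟨⟨x', y'⟩, h1, h2⟩ := h
    have := hvert _ h1
    rw [h2] at this
    simp only at this
    subst this
    exact ⟨y', h1, h2⟩
  have hne : ∀ x, m ≤ x ∧ x ≤ M → ∃ y, (x, y) ∈ K := by
    rintro x ⟨h1, h2⟩
    rcases h1.eq_or_lt with rfl | h1
    · obtain ⟨⟨p, q⟩, hp, rfl⟩ := hm
      obtain ⟨y, hy, -⟩ := hback _ _ hp
      exact ⟨y, hfK hy⟩
    rcases h2.eq_or_lt with rfl | h2
    · obtain ⟨⟨p, q⟩, hp, rfl⟩ := hM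
      obtain ⟨y, hy, -⟩ := hback _ _ hp
      exact ⟨y, hfK hy⟩
    obtain ⟨y1, y2, -, h⟩ := hs x h1 h2
    obtain ⟨y, hy, -⟩ := hback _ _ ((h y1).2 (Or.inl rfl))
    exact ⟨y, hfK hy⟩
  have hsl : ∀ x, ∃ a b, (m ≤ x ∧ x ≤ M) → (a ≤ b ∧ ∀ y, (x, y) ∈ K ↔ a ≤ y ∧ y ≤ b) := by
    intro x
    by_cases hx : m ≤ x ∧ x ≤ M
    · obtain ⟨a, b, h⟩ := slice_Icc hK (hT x) (hne x hx)
      exact ⟨a, b, fun _ => h⟩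
    · exact ⟨0, 0, fun h => absurd h hx⟩
  choose l u hlu using hsl
  have hKx : ∀ x y, (x, y) ∈ K → m ≤ x ∧ x ≤ M := by
    intro x y h
    obtain ⟨a, b, hab, h1⟩ := slice_Icc hK (hT x) ⟨y, h⟩
    have : (x, b) ∈ frontier K := by
      rw [hK.isClosed.frontier_eq]
      refine ⟨(h1 b).2 ⟨hab, le_rfl⟩, fun h2 => ?_⟩
      obtain ⟨δ, hδ, h5, h6, -, -⟩ := int_vert h2
      have := (h1 _).1 h6
      linarith
    have h2 := hb _ (hc.isClosed.frontier_subset (hfC _ this))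
    rwa [hvert _ this] at h2
  have hKi : ∀ x y, (x, y) ∈ interior K → (m < x ∧ x < M) ∧ l x < y ∧ y < u x := by
    intro x y h
    obtain ⟨δ, hδ, h3, h4, h5, h6⟩ := int_vert h
    have h5 := hKx _ _ h5
    have h6 := hKx _ _ h6
    have h0 : m < x ∧ x < M := ⟨by linarith, by linarith⟩
    obtain ⟨-, h1⟩ := hlu x ⟨h0.1.le, h0.2.le⟩
    have h3 := (h1 _).1 h3
    have h4 := (h1 _).1 h4
    exact ⟨h0, by linarith, by linarith⟩
  have hfl : ∀ x, m < x → x < M → (x, l x) ∈ frontier K ∧ (x, u x) ∈ frontier K := by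
    intro x h1 h2
    obtain ⟨h3, h4⟩ := hlu x ⟨h1.le, h2.le⟩
    rw [hK.isClosed.frontier_eq]
    exact ⟨⟨(h4 _).2 ⟨le_rfl, h3⟩, fun h => lt_irrefl _ (hKi _ _ h).2.1⟩,
      ⟨(h4 _).2 ⟨h3, le_rfl⟩, fun h => lt_irrefl _ (hKi _ _ h).2.2⟩⟩
  have hltl : ∀ x, m < x → x < M → l x < u x := by
    intro x h1 h2
    obtain ⟨h3, h4⟩ := hlu x ⟨h1.le, h2.le⟩
    refine lt_of_le_of_ne h3 fun he => ?_
    obtain ⟨y1, y2, h12, h5⟩ := hs x h1 h2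
    obtain ⟨z1, hz1, hz1'⟩ := hback _ _ ((h5 y1).2 (Or.inl rfl))
    obtain ⟨z2, hz2, hz2'⟩ := hback _ _ ((h5 y2).2 (Or.inr rfl))
    have e1 := (h4 _).1 (hfK hz1)
    have e2 := (h4 _).1 (hfK hz2)
    have : z1 = z2 := by linarith
    rw [this, hz2', Prod.mk.injEq] at hz1'
    linarith [hz1'.2]
  refine ⟨m, M, l, u, hmM, hK.isClosed, ?_, ?_, hltl, (hlu m ⟨le_rfl, hmM.le⟩).1,
    (hlu M ⟨hmM.le, le_rfl⟩).1, hreg⟩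
  · intro x y
    constructor
    · intro h
      have := hKx _ _ h
      exact ⟨this, ((hlu x this).2 y).1 h⟩
    · rintro ⟨h1, h2⟩
      exact ((hlu x h1).2 y).2 h2
  · intro x y
    refine ⟨hKi x y, ?_⟩
    rintro ⟨⟨h1, h2⟩, h3, h4⟩
    by_contra hn
    have hy : (x, y) ∈ frontier K := by
      rw [hK.isClosed.frontier_eq]
      exact ⟨((hlu x ⟨h1.le, h2.le⟩).2 y).2 ⟨h3.le, h4.le⟩, hn⟩
    obtain ⟨hl, hu⟩ := hfl x h1 h2
    obtain ⟨y1, y2, h12, h5⟩ := hs x h1 h2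
    have key : ∀ z, (x, z) ∈ frontier K → (F (x, z) = (x, y1) ∨ F (x, z) = (x, y2)) := by
      intro z hz
      have e1 := hfC _ hz
      have e2 := hvert _ hz
      have e3 : F (x, z) = (x, (F (x, z)).2) := by rw [Prod.ext_iff]; exact ⟨e2, rfl⟩
      rw [e3] at e1
      rcases (h5 _).1 e1 with h | h
      · left; rw [e3, h]
      · right; rw [e3, h]
    have ne : ∀ z w, z < w → (x, z) ∈ frontier K → (x, w) ∈ frontier K → F (x, z) ≠ F (x, w) := by
      intro z w hzw hz hw he
      have := hinj hz hw he
      rw [Prod.mk.injEq] at this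
      linarith [this.2]
    have n1 := ne _ _ h3 hl hy
    have n2 := ne _ _ h4 hy hu
    have n3 := ne _ _ (h3.trans h4) hl hu
    rcases key _ hl with k1 | k1 <;> rcases key _ hu with k2 | k2 <;> rcases key _ hy with k3 | k3 <;>
      simp_all

def ori (p q r : ℝ × ℝ) : ℝ := (q.1 - p.1) * (r.2 - p.2) - (q.2 - p.2) * (r.1 - p.1)

lemma ori_rot (p q r : ℝ × ℝ) : ori q r p = ori p q r := by unfold ori; ring
lemma ori_swap (p q r : ℝ × ℝ) : ori q p r = - ori p q r := by unfold ori; ring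

lemma mem_tri_weights {v w z p : ℝ × ℝ} (hD : ori v w z ≠ 0) :
    p = (ori p w z / ori v w z) • v + (ori v p z / ori v w z) • w + (ori v w p / ori v w z) • z := by
  rw [Prod.ext_iff]
  simp only [Prod.fst_add, Prod.smul_fst, Prod.snd_add, Prod.smul_snd, smul_eq_mul]
  constructor <;> field_simp <;> unfold ori <;> ring

lemma weights_sum {v w z p : ℝ × ℝ} (hD : ori v w z ≠ 0) :
    (ori p w z / ori v w z) + (ori v p z / ori v w z) + (ori v w p / ori v w z) = 1 := by
  field_simp; unfold ori; ring

lemma div_nonneg_of_mul {a b : ℝ} (h : 0 ≤ a * b) : 0 ≤ a / b := by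
  rcases mul_nonneg_iff.1 h with ⟨h1, h2⟩ | ⟨h1, h2⟩
  · exact div_nonneg h1 h2
  · exact div_nonneg_of_nonpos h1 h2

lemma mem_tri {v w z p : ℝ × ℝ} (hD : ori v w z ≠ 0) (h1 : 0 ≤ ori p w z * ori v w z)
    (h2 : 0 ≤ ori v p z * ori v w z) (h3 : 0 ≤ ori v w p * ori v w z) :
    p ∈ convexHull ℝ {v, w, z} := by
  rw [mem_tri_weights (p := p) hD]
  have hc := convex_convexHull ℝ ({v, w, z} : Set (ℝ × ℝ))
  have h := hc.sum_mem (t := (Finset.univ : Finset (Fin 3))) (w := ![ori p w z / ori v w z,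
    ori v p z / ori v w z, ori v w p / ori v w z]) (z := ![v, w, z]) ?_ ?_ ?_
  · rw [Fin.sum_univ_three] at h
    exact h
  · intro i _
    fin_cases i
    · exact div_nonneg_of_mul h1
    · exact div_nonneg_of_mul h2
    · exact div_nonneg_of_mul h3
  · rw [Fin.sum_univ_three]; exact weights_sum hD
  · intro i _
    apply subset_convexHull
    fin_cases i <;> simp

lemma ori_halfplane {v w z p : ℝ × ℝ} (hp : p ∈ convexHull ℝ {v, w, z}) :
    0 ≤ ori v w p * ori v w z := by
  have hc : Convex ℝ {p | 0 ≤ ori v w p * ori v w z} := by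
    intro a ha b hb s t hs ht hst
    simp only [mem_ofPred_eq] at *
    have : ori v w (s • a + t • b) = s * ori v w a + t * ori v w b := by
      obtain rfl : t = 1 - s := by linarith
      simp [ori]; ring
    rw [this]
    nlinarith [mul_nonneg hs ha, mul_nonneg ht hb]
  refine convexHull_min ?_ hc hp
  rintro a (rfl | rfl | rfl)
  · simp [ori]
  · simp [ori, mul_comm]
  · exact mul_self_nonneg (ori v w a)

lemma ori_cont1 (w z : ℝ × ℝ) : Continuous (fun p => ori p w z) := by unfold ori; fun_prop
lemma ori_cont2 (w z : ℝ × ℝ) : Continuous (fun p => ori w p z) := by unfold ori; fun_prop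
lemma ori_cont3 (w z : ℝ × ℝ) : Continuous (fun p => ori w z p) := by unfold ori; fun_prop

lemma tri_interior {v w z p : ℝ × ℝ} (hD : ori v w z ≠ 0) (h1 : 0 < ori p w z * ori v w z)
    (h2 : 0 < ori v p z * ori v w z) (h3 : 0 < ori v w p * ori v w z) :
    p ∈ interior (convexHull ℝ {v, w, z}) := by
  rw [mem_interior_iff_mem_nhds]
  filter_upwards [((ori_cont1 w z).mul_const (ori v w z)).continuousAt.eventually (lt_mem_nhds h1),
    ((ori_cont2 v z).mul_const (ori v w z)).continuousAt.eventually (lt_mem_nhds h2),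
    ((ori_cont3 v w).mul_const (ori v w z)).continuousAt.eventually (lt_mem_nhds h3)] with x a b c
  exact mem_tri hD a.le b.le c.le

lemma tri_regular {v w z : ℝ × ℝ} (hD : ori v w z ≠ 0) :
    convexHull ℝ {v, w, z} ⊆ closure (interior (convexHull ℝ {v, w, z})) := by
  rw [(convex_convexHull ℝ _).closure_interior_eq_closure_of_nonempty_interior]
  · exact subset_closure
  · have h0 : 0 < ori v w z * ori v w z := mul_self_pos.2 hD
    refine ⟨((1/3 : ℝ) • v + (1/3 : ℝ) • w + (1/3 : ℝ) • z), tri_interior hD ?_ ?_ ?_⟩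
    all_goals
      simp only [ori, Prod.fst_add, Prod.smul_fst, Prod.snd_add, Prod.smul_snd, smul_eq_mul] at *
      nlinarith

lemma ori_ne {v w z : ℝ × ℝ} (h : AffineIndependent ℝ ![v, w, z]) : ori v w z ≠ 0 := by
  intro h0
  rw [affineIndependent_iff_not_collinear_set] at h
  apply h
  unfold ori at h0
  rw [collinear_iff_of_mem (p₀ := v) (by simp)]
  by_cases hvw : w = v
  · refine ⟨z - v, ?_⟩
    rintro p (rfl | rfl | rfl)
    · exact ⟨0, by simp⟩
    · exact ⟨0, by simp [hvw]⟩
    · exact ⟨1, by simp⟩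
  · refine ⟨w - v, ?_⟩
    rintro p (rfl | rfl | rfl)
    · exact ⟨0, by simp⟩
    · exact ⟨1, by simp⟩
    · by_cases h1 : w.1 - v.1 = 0
      · have h2 : w.2 - v.2 ≠ 0 := fun h2 => hvw (Prod.ext (by linarith) (by linarith))
        rw [h1] at h0
        have h3 : p.1 - v.1 = 0 := by
          have : (w.2 - v.2) * (p.1 - v.1) = 0 := by linarith
          exact (mul_eq_zero.1 this).resolve_left h2
        refine ⟨(p.2 - v.2) / (w.2 - v.2), ?_⟩
        ext
        · simp [h1]; linarith
        · simp; field_simp; ring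
      · refine ⟨(p.1 - v.1) / (w.1 - v.1), ?_⟩
        ext
        · simp; field_simp; ring
        · simp; field_simp; linarith

section tri

variable {ι : Type} [Fintype ι] [DecidableEq ι]

structure IsTri (D : TriDisk ι) (t : ι × ι × ι) (v w z : ι) : Prop where
  mem : t ∈ D.tris
  vs : vset t = {v, w, z}
  ts : triSet D.pos t = convexHull ℝ {D.pos v, D.pos w, D.pos z}
  or : ori (D.pos v) (D.pos w) (D.pos z) ≠ 0

lemma IsTri.rot {D : TriDisk ι} {t : ι × ι × ι} {v w z : ι} (h : IsTri D t v w z) :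
    IsTri D t w z v where
  mem := h.mem
  vs := by rw [h.vs]; ext; simp; tauto
  ts := by
    rw [h.ts]; congr 1; ext; simp; tauto
  or := by rw [ori_rot]; exact h.or

lemma IsTri.swap {D : TriDisk ι} {t : ι × ι × ι} {v w z : ι} (h : IsTri D t v w z) :
    IsTri D t w v z where
  mem := h.mem
  vs := by rw [h.vs]; ext; simp; tauto
  ts := by
    rw [h.ts]; congr 1; ext; simp; tauto
  or := by rw [ori_swap]; exact neg_ne_zero.2 h.or

lemma isTri_self (D : TriDisk ι) {t : ι × ι × ι} (ht : t ∈ D.tris) :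
    IsTri D t t.1 t.2.1 t.2.2 :=
  ⟨ht, rfl, rfl, ori_ne (D.indep t ht)⟩

lemma exists_isTri (D : TriDisk ι) {t : ι × ι × ι} (ht : t ∈ D.tris) {v w : ι}
    (hv : v ∈ vset t) (hw : w ∈ vset t) (hvw : v ≠ w) : ∃ z, IsTri D t v w z := by
  have h := isTri_self D ht
  simp only [vset, Finset.mem_insert, Finset.mem_singleton] at hv hw
  rcases hv with rfl | rfl | rfl <;> rcases hw with rfl | rfl | rfl <;> try exact absurd rfl hvw
  · exact ⟨_, h⟩
  · exact ⟨_, h.rot.rot.swap⟩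
  · exact ⟨_, h.swap⟩
  · exact ⟨_, h.rot⟩
  · exact ⟨_, h.rot.rot⟩
  · exact ⟨_, h.rot.swap⟩

lemma IsTri.ne {D : TriDisk ι} {t : ι × ι × ι} {v w z : ι} (h : IsTri D t v w z) : v ≠ w := by
  rintro rfl
  apply h.or
  simp [ori]

lemma IsTri.sub {D : TriDisk ι} {t : ι × ι × ι} {v w z : ι} (h : IsTri D t v w z) :
    triSet D.pos t ⊆ D.space := by
  intro p hp
  simp only [TriDisk.space, mem_iUnion]
  exact ⟨t, h.mem, hp⟩

lemma mem_space {D : TriDisk ι} {p : ℝ × ℝ} : p ∈ D.space ↔ ∃ t ∈ D.tris, p ∈ triSet D.pos t := by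
  simp [TriDisk.space]

lemma triSet_compact (D : TriDisk ι) (t : ι × ι × ι) : IsCompact (triSet D.pos t) :=
  (toFinite _).isCompact_convexHull ℝ

lemma space_compact (D : TriDisk ι) : IsCompact D.space :=
  D.tris.isCompact_biUnion fun t _ => triSet_compact D t

lemma space_reg (D : TriDisk ι) : D.space ⊆ closure (interior D.space) := by
  intro p hp
  obtain ⟨t, ht, hp⟩ := mem_space.1 hp
  have h := isTri_self D ht
  have h1 := tri_regular h.or (h.ts ▸ hp)
  rw [← h.ts] at h1
  exact closure_mono (interior_mono h.sub) h1

lemma edge_of_frontier {D : TriDisk ι} {q : ℝ × ℝ} (hq : q ∈ frontier D.space) :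
    ∃ t v w z, IsTri D t v w z ∧ q ∈ segment ℝ (D.pos v) (D.pos w) := by
  rw [(space_compact D).isClosed.frontier_eq] at hq
  obtain ⟨hq, hi⟩ := hq
  obtain ⟨t, ht, hp⟩ := mem_space.1 hq
  have key : ∀ v w z, IsTri D t v w z → ori (D.pos v) (D.pos w) q = 0 →
      q ∈ segment ℝ (D.pos v) (D.pos w) := by
    intro v w z h h0
    have h1 := mem_tri_weights (p := q) h.or
    have h2 := weights_sum (p := q) h.or
    have hp1 := h.ts ▸ hp
    have hp2 := h.rot.ts ▸ hp
    have hp3 := h.rot.rot.ts ▸ hp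
    have e1 := div_nonneg_of_mul (ori_halfplane hp2)
    have e2 := div_nonneg_of_mul (ori_halfplane hp3)
    rw [ori_rot q, ori_rot (D.pos v)] at e1
    rw [← ori_rot (D.pos z) (D.pos v) q, ← ori_rot (D.pos z) (D.pos v) (D.pos w)] at e2
    rw [h0, zero_div, zero_smul, add_zero] at h1
    rw [h0, zero_div, add_zero] at h2
    exact ⟨_, _, e1, e2, h2, h1.symm⟩
  have h := isTri_self D ht
  set v := t.1
  set w := t.2.1
  set z := t.2.2
  by_contra! hcon
  have n1 : ori (D.pos v) (D.pos w) q ≠ 0 := fun h0 => hcon _ _ _ _ h (key _ _ _ h h0)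
  have n2 : ori (D.pos w) (D.pos z) q ≠ 0 := fun h0 => hcon _ _ _ _ h.rot (key _ _ _ h.rot h0)
  have n3 : ori (D.pos z) (D.pos v) q ≠ 0 :=
    fun h0 => hcon _ _ _ _ h.rot.rot (key _ _ _ h.rot.rot h0)
  have p1 := ori_halfplane (h.ts ▸ hp)
  have p2 := ori_halfplane (h.rot.ts ▸ hp)
  have p3 := ori_halfplane (h.rot.rot.ts ▸ hp)
  have p1 := lt_of_le_of_ne p1 (mul_ne_zero n1 h.or).symm
  have p2 := lt_of_le_of_ne p2 (mul_ne_zero n2 h.rot.or).symm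
  have p3 := lt_of_le_of_ne p3 (mul_ne_zero n3 h.rot.rot.or).symm
  apply hi
  refine interior_mono h.sub ?_
  rw [h.ts]
  refine tri_interior h.or ?_ ?_ p1
  · rwa [ori_rot q, ori_rot (D.pos v)] at p2
  · rwa [← ori_rot (D.pos z) (D.pos v) q, ← ori_rot (D.pos z) (D.pos v) (D.pos w)] at p3

lemma ori_combo1 (v w z : ℝ × ℝ) {a b : ℝ} (hab : a + b = 1) :
    ori (a • v + b • w) w z = a * ori v w z := by
  obtain rfl : b = 1 - a := by linarith
  simp [ori]; ring

lemma ori_combo2 (v w z : ℝ × ℝ) {a b : ℝ} (hab : a + b = 1) :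
    ori v (a • v + b • w) z = b * ori v w z := by
  obtain rfl : a = 1 - b := by linarith
  simp [ori]; ring

lemma left_mem_of_mem {D : TriDisk ι} {t s : ι × ι × ι} {v w z : ι} (h : IsTri D t v w z)
    (hs : s ∈ D.tris) {q : ℝ × ℝ} (hq : q ∈ openSegment ℝ (D.pos v) (D.pos w))
    (hqs : q ∈ triSet D.pos s) : v ∈ vset s := by
  by_contra hv
  obtain ⟨a, b, ha, hb, hab, rfl⟩ := hq
  have hqt : a • D.pos v + b • D.pos w ∈ triSet D.pos t := by
    rw [h.ts]
    exact (convex_convexHull ℝ _) (subset_convexHull _ _ (by simp))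
      (subset_convexHull _ _ (by simp)) ha.le hb.le hab
  have hg : a • D.pos v + b • D.pos w ∈ triSet D.pos s ∩ triSet D.pos t := ⟨hqs, hqt⟩
  rw [D.glue s hs t h.mem] at hg
  have hc : Convex ℝ {p | ori p (D.pos w) (D.pos z) = 0} := by
    intro x hx y hy s t _ _ hst
    simp only [mem_ofPred_eq] at *
    have : ori (s • x + t • y) (D.pos w) (D.pos z)
        = s * ori x (D.pos w) (D.pos z) + t * ori y (D.pos w) (D.pos z) := by
      obtain rfl : t = 1 - s := by linarith
      simp [ori]; ring
    rw [this, hx, hy]; simp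
  have h0 := convexHull_min (t := {p | ori p (D.pos w) (D.pos z) = 0}) ?_ hc hg
  · simp only [mem_ofPred_eq] at h0
    rw [ori_combo1 _ _ _ hab] at h0
    exact (mul_ne_zero ha.ne' h.or) h0
  · rintro _ ⟨i, hi, rfl⟩
    simp only [Finset.coe_inter, mem_inter_iff, Finset.mem_coe, h.vs, Finset.mem_insert,
      Finset.mem_singleton] at hi
    rcases hi with ⟨hi, rfl | rfl | rfl⟩
    · exact absurd hi hv
    · simp [ori]
    · simp [ori, mul_comm]

lemma opp_side {D : TriDisk ι} {t : ι × ι × ι} {v w z : ι} (h : IsTri D t v w z)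
    {q : ℝ × ℝ} (hq : q ∈ openSegment ℝ (D.pos v) (D.pos w)) (hi : q ∈ interior D.space) :
    ∃ s z', IsTri D s v w z' ∧
      ori (D.pos v) (D.pos w) (D.pos z') * ori (D.pos v) (D.pos w) (D.pos z) < 0 := by
  have e1 : ∀ᶠ p in nhds q, ∀ s ∈ D.tris, p ∈ triSet D.pos s → q ∈ triSet D.pos s := by
    rw [Filter.eventually_all_finset]
    intro s _
    by_cases hqs : q ∈ triSet D.pos s
    · exact Filter.Eventually.of_forall fun _ _ => hqs
    · filter_upwards [(triSet_compact D s).isClosed.isOpen_compl.mem_nhds hqs] with p hp hp'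
      exact absurd hp' hp
  have e2 : ∀ᶠ p in nhds q, p ∈ interior D.space := isOpen_interior.mem_nhds hi
  have hc : Continuous fun e : ℝ => q + e • (q - D.pos z) := by fun_prop
  have hc0 : Filter.Tendsto (fun e : ℝ => q + e • (q - D.pos z)) (nhdsWithin 0 (Ioi 0)) (nhds q) := by
    have := hc.tendsto 0
    simp only [zero_smul, add_zero] at this
    exact this.mono_left nhdsWithin_le_nhds
  obtain ⟨e, ⟨he1, he2⟩, he⟩ := ((hc0.eventually (e1.and e2)).and self_mem_nhdsWithin).exists
  obtain ⟨s, hs, hps⟩ := mem_space.1 (interior_subset he2)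
  have hqs := he1 s hs hps
  have hv := left_mem_of_mem h hs hq hqs
  have hw := left_mem_of_mem h.swap hs (by rwa [openSegment_symm]) hqs
  obtain ⟨z', hz'⟩ := exists_isTri D hs hv hw h.ne
  refine ⟨s, z', hz', ?_⟩
  have h1 := ori_halfplane (hz'.ts ▸ hps)
  have h2 : ori (D.pos v) (D.pos w) (q + e • (q - D.pos z)) =
      - e * ori (D.pos v) (D.pos w) (D.pos z) := by
    obtain ⟨a, b, ha, hb, hab, rfl⟩ := hq
    obtain rfl : a = 1 - b := by linarith
    simp [ori]; ring
  rw [h2] at h1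
  have he : 0 < e := he
  have h3 := mul_ne_zero hz'.or h.or
  refine lt_of_le_of_ne ?_ h3
  by_contra! h4
  nlinarith [mul_pos he h4]

lemma exists_bedge {D : TriDisk ι} {q : ℝ × ℝ} (hq : q ∈ frontier D.space)
    (hv : ∀ i, D.pos i ≠ q) :
    ∃ v w, D.IsBoundaryEdge v w ∧ q ∈ openSegment ℝ (D.pos v) (D.pos w) := by
  obtain ⟨t, v, w, z, h, hs⟩ := edge_of_frontier hq
  have hqo : q ∈ openSegment ℝ (D.pos v) (D.pos w) :=
    mem_openSegment_of_ne_left_right (hv v) (hv w) hs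
  refine ⟨v, w, ⟨⟨h.ne, t, h.mem, by simp [h.vs], by simp [h.vs]⟩, ?_⟩, hqo⟩
  have hcl : IsClosed (frontier D.space) := isClosed_frontier
  suffices ho : openSegment ℝ (D.pos v) (D.pos w) ⊆ frontier D.space by
    have := closure_minimal ho hcl
    rw [closure_openSegment] at this
    exact this
  intro p hp
  rw [(space_compact D).isClosed.frontier_eq]
  refine ⟨?_, fun hi => ?_⟩
  · refine h.sub ?_
    rw [h.ts]
    exact (convex_convexHull ℝ _).segment_subset (subset_convexHull _ _ (by simp))
      (subset_convexHull _ _ (by simp)) (openSegment_subset_segment _ _ _ hp)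
  · obtain ⟨s, z', h', hneg⟩ := opp_side h hp hi
    rw [(space_compact D).isClosed.frontier_eq] at hq
    apply hq.2
    rw [mem_interior_iff_mem_nhds]
    have key : ∀ {s z}, IsTri D s v w z → ∀ᶠ p in nhds q,
        0 ≤ ori (D.pos v) (D.pos w) p * ori (D.pos v) (D.pos w) (D.pos z) → p ∈ D.space := by
      intro s z h
      obtain ⟨a, b, ha, hb, hab, rfl⟩ := hqo
      have h0 : 0 < ori (D.pos v) (D.pos w) (D.pos z) * ori (D.pos v) (D.pos w) (D.pos z) :=
        mul_self_pos.2 h.or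
      have h1 : 0 < ori (a • D.pos v + b • D.pos w) (D.pos w) (D.pos z) *
          ori (D.pos v) (D.pos w) (D.pos z) := by
        rw [ori_combo1 _ _ _ hab, mul_assoc]; positivity
      have h2 : 0 < ori (D.pos v) (a • D.pos v + b • D.pos w) (D.pos z) *
          ori (D.pos v) (D.pos w) (D.pos z) := by
        rw [ori_combo2 _ _ _ hab, mul_assoc]; positivity
      filter_upwards [((ori_cont1 _ _).mul_const _).continuousAt.eventually (lt_mem_nhds h1),
        ((ori_cont2 _ _).mul_const _).continuousAt.eventually (lt_mem_nhds h2)] with x e1 e2 e3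
      refine h.sub ?_
      rw [h.ts]
      exact mem_tri h.or e1.le e2.le e3
    filter_upwards [key h, key h'] with x e1 e2
    rcases le_total 0 (ori (D.pos v) (D.pos w) x * ori (D.pos v) (D.pos w) (D.pos z)) with h3 | h3
    · exact e1 h3
    · apply e2
      by_contra! h4
      rcases mul_neg_iff.1 hneg with ⟨g1, g2⟩ | ⟨g1, g2⟩ <;> nlinarith

end tri

section final

variable {ι : Type} [Fintype ι] [DecidableEq ι]

lemma roof_closed (D : TriDisk ι) : IsClosed D.roof := by
  unfold TriDisk.roof
  refine isClosed_iUnion_of_finite fun a => isClosed_iUnion_of_finite fun b =>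
    isClosed_iUnion_of_finite fun _ => ?_
  rw [← convexHull_pair]
  exact ((toFinite _).isCompact_convexHull ℝ).isClosed

lemma roof_above {D : TriDisk ι} {p : ℝ × ℝ} (hp : p ∈ D.roof) (s : ℝ) (hs : 0 ≤ s) :
    (p.1, p.2 + s) ∉ interior D.space := by
  simp only [TriDisk.roof, mem_iUnion] at hp
  obtain ⟨a, b, h, hp⟩ := hp
  exact h.2 p hp s hs

lemma mem_roof {D : TriDisk ι} {p : ℝ × ℝ} {v w : ι} (h : D.IsRoofEdge v w)
    (hp : p ∈ segment ℝ (D.pos v) (D.pos w)) : p ∈ D.roof := by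
  simp only [TriDisk.roof, mem_iUnion]
  exact ⟨v, w, h, hp⟩

lemma upper_roof1 {D : TriDisk ι} {m M : ℝ} {l u : ℝ → ℝ} (h : Reg D.space m M l u) {x : ℝ}
    (hx : m < x ∧ x < M) (hn : ∀ i, D.pos i ≠ (x, u x)) : (x, u x) ∈ D.roof := by
  have hf : (x, u x) ∈ frontier D.space := (h.fr _ _).2 (Or.inl ⟨hx, Or.inr rfl⟩)
  obtain ⟨v, w, hb, hq⟩ := exists_bedge hf hn
  have hq := openSegment_subset_segment _ _ _ hq
  refine mem_roof ⟨hb, ?_⟩ hq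
  rintro ⟨p1, p2⟩ hp s hs hi
  obtain ⟨h1, h2, h3⟩ := (h.int _ _).1 hi
  have hpl : p2 = l p1 := by
    rcases (h.fr _ _).1 (hb.2 hp) with ⟨-, h4 | h4⟩ | ⟨h4 | h4, -⟩
    · exact h4
    · linarith
    · linarith [h1.1]
    · linarith [h1.2]
  have hsub : segment ℝ (p1, p2) (x, u x) ⊆ segment ℝ (D.pos v) (D.pos w) :=
    (convex_segment _ _).segment_subset hp hq
  have hstrip : ∀ r ∈ segment ℝ (p1, p2) (x, u x), r.1 ∈ Ioo m M := by
    have hc : Convex ℝ {r : ℝ × ℝ | r.1 ∈ Ioo m M} :=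
      (convex_Ioo m M).linear_preimage (LinearMap.fst ℝ ℝ ℝ)
    intro r hr
    exact hc.segment_subset (x := (p1, p2)) (y := (x, u x)) h1 hx hr
  have hcont : ContinuousOn (fun r : ℝ × ℝ => r.2 - (l r.1 + u r.1) / 2)
      (segment ℝ (p1, p2) (x, u x)) := by
    have e1 : ContinuousOn (fun r : ℝ × ℝ => l r.1) (segment ℝ (p1, p2) (x, u x)) :=
      h.lcont.comp continuous_fst.continuousOn hstrip
    have e2 : ContinuousOn (fun r : ℝ × ℝ => u r.1) (segment ℝ (p1, p2) (x, u x)) :=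
      h.ucont.comp continuous_fst.continuousOn hstrip
    exact continuous_snd.continuousOn.sub ((e1.add e2).div_const 2)
  have hpre : IsPreconnected (segment ℝ (p1, p2) (x, u x)) := (convex_segment _ _).isPreconnected
  have hiv := hpre.intermediate_value (left_mem_segment ℝ _ _) (right_mem_segment ℝ _ _) hcont
  have l1 := h.ltl _ h1.1 h1.2
  have l2 := h.ltl _ hx.1 hx.2
  obtain ⟨⟨r1, r2⟩, hr, h0⟩ := hiv (show (0 : ℝ) ∈ _ from ⟨by simp only; linarith, by simp only; linarith⟩)
  have hr1 := hstrip _ hr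
  have l3 := h.ltl _ hr1.1 hr1.2
  simp only at h0 hr1 l3
  rcases (h.fr _ _).1 (hb.2 (hsub hr)) with ⟨-, h4 | h4⟩ | ⟨h4 | h4, -⟩
  · linarith
  · linarith
  · linarith [hr1.1]
  · linarith [hr1.2]

lemma upper_roof {D : TriDisk ι} {m M : ℝ} {l u : ℝ → ℝ} (h : Reg D.space m M l u) {x : ℝ}
    (hx : m < x ∧ x < M) : (x, u x) ∈ D.roof := by
  have hV : (range fun i => (D.pos i).1).Finite := finite_range _
  have hd := hV.countable.dense_compl ℝ
  have hcl := hd.open_subset_closure_inter (isOpen_Ioo (a := m) (b := M)) hx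
  have hc : ContinuousWithinAt (fun x => (x, u x)) (Ioo m M ∩ (range fun i => (D.pos i).1)ᶜ) x :=
    ((continuousOn_id.prodMk h.ucont) x hx).mono inter_subset_left
  have := hc.mem_closure_image hcl
  refine closure_minimal ?_ (roof_closed D) this
  rintro _ ⟨x', ⟨h1, h2⟩, rfl⟩
  exact upper_roof1 h h1 fun i hi => h2 ⟨i, by simp [hi]⟩

lemma side_roof {D : TriDisk ι} {m M : ℝ} {l u : ℝ → ℝ} (h : Reg D.space m M l u) {c y : ℝ}
    (hc : c = m ∨ c = M) (hy : l c ≤ y ∧ y ≤ u c) : (c, y) ∈ D.roof := by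
  rcases (hy.1.trans hy.2).eq_or_lt with he | hlt
  · have hyu : y = u c := by linarith
    rw [hyu]
    have hsub : gr u (Ioo m M) ⊆ D.roof := by
      rintro ⟨x, z⟩ ⟨h1, h2⟩
      simp only at h1 h2
      rw [h2]
      exact upper_roof h h1
    rcases hc with rfl | rfl
    · exact closure_minimal hsub (roof_closed D) (h.cum h.lt)
    · exact closure_minimal hsub (roof_closed D) (h.cuM h.lt)
  · have hV : (range fun i => (D.pos i).2).Finite := finite_range _
    have hd := hV.countable.dense_compl ℝ
    have hcl := hd.open_subset_closure_inter (isOpen_Ioo (a := l c) (b := u c))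
    have hy' : y ∈ closure (Ioo (l c) (u c)) := by rw [closure_Ioo hlt.ne]; exact hy
    have hy'' := closure_minimal hcl isClosed_closure hy'
    have hcc : Continuous (fun z : ℝ => (c, z)) := by fun_prop
    have := hcc.continuousWithinAt.mem_closure_image hy''
    refine closure_minimal ?_ (roof_closed D) this
    rintro _ ⟨z, ⟨h1, h2⟩, rfl⟩
    have hf : (c, z) ∈ frontier D.space := (h.fr _ _).2 (Or.inr ⟨hc, h1.1.le, h1.2.le⟩)
    obtain ⟨v, w, hb, hq⟩ := exists_bedge hf fun i hi => h2 ⟨i, by simp [hi]⟩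
    refine mem_roof ⟨hb, ?_⟩ (openSegment_subset_segment _ _ _ hq)
    have hK : ∀ p ∈ segment ℝ (D.pos v) (D.pos w), m ≤ p.1 ∧ p.1 ≤ M := fun p hp =>
      ((h.mem p.1 p.2).1 (h.closed.frontier_subset (hb.2 hp))).1
    have hv := hK _ (left_mem_segment ℝ _ _)
    have hw := hK _ (right_mem_segment ℝ _ _)
    obtain ⟨a, b, ha, hb', hab, hz⟩ := hq
    have hz1 : a * (D.pos v).1 + b * (D.pos w).1 = c := by
      have := congrArg Prod.fst hz
      simpa using this
    have hvc : (D.pos v).1 = c ∧ (D.pos w).1 = c := by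
      obtain rfl : a = 1 - b := by linarith
      rcases hc with rfl | rfl
      · constructor <;> nlinarith
      · constructor <;> nlinarith
    intro p hp s _ hi
    have hpc : p.1 = c := by
      obtain ⟨a, b, ha, hb', hab, rfl⟩ := hp
      simp [hvc.1, hvc.2, ← add_mul, hab]
    have := ((h.int _ _).1 hi).1
    rw [hpc] at this
    rcases hc with rfl | rfl
    · exact lt_irrefl _ this.1
    · exact lt_irrefl _ this.2

lemma lower_not_roof {D : TriDisk ι} {m M : ℝ} {l u : ℝ → ℝ} (h : Reg D.space m M l u) {x : ℝ}
    (hx : m < x ∧ x < M) : (x, l x) ∉ D.roof := by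
  intro hr
  have hlt := h.ltl x hx.1 hx.2
  refine roof_above hr ((u x - l x) / 2) (by linarith) ?_
  exact (h.int _ _).2 ⟨hx, by simp only; linarith, by simp only; linarith⟩

lemma not_nhds {D : TriDisk ι} {m M : ℝ} {l u : ℝ → ℝ} (h : Reg D.space m M l u) {p : ℝ × ℝ}
    (hp : p ∈ closure (gr l (Ioo m M))) : D.roof ∉ nhdsWithin p (frontier D.space) := by
  intro hn
  obtain ⟨U, hU, hUs⟩ := mem_nhdsWithin_iff_exists_mem_nhds_inter.1 hn
  obtain ⟨⟨x, z⟩, hxU, h1, h2⟩ := mem_closure_iff_nhds.1 hp U hU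
  simp only at h1 h2
  subst h2
  exact lower_not_roof h h1 (hUs ⟨hxU, (h.fr _ _).2 (Or.inl ⟨h1, Or.inl rfl⟩)⟩)

lemma bad_not_collinear {B P : Set (ℝ × ℝ)} {F : ℝ × ℝ → ℝ × ℝ} (hinj : InjOn F B)
    (hvert : ∀ p ∈ B, (F p).1 = p.1) (hPB : P ⊆ B) (hP : Bad P) : ¬ Collinear ℝ (F '' P) := by
  intro hc
  obtain ⟨p, hp, q, hq, r, hr, hpq, h1, h2⟩ := hP
  rw [collinear_iff_of_mem (mem_image_of_mem F hp)] at hc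
  obtain ⟨v, hv⟩ := hc
  obtain ⟨s, hs⟩ := hv _ (mem_image_of_mem F hq)
  obtain ⟨t, ht⟩ := hv _ (mem_image_of_mem F hr)
  have vp := hvert _ (hPB hp)
  have vq := hvert _ (hPB hq)
  have vr := hvert _ (hPB hr)
  have hs1 : (F q).1 = s * v.1 + (F p).1 := by rw [hs]; simp
  have ht1 : (F r).1 = t * v.1 + (F p).1 := by rw [ht]; simp
  have hs0 : s ≠ 0 := by
    rintro rfl
    rw [zero_smul, vadd_eq_add, zero_add] at hs
    exact hpq (hinj (hPB hq) (hPB hp) hs).symm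
  have hv0 : v.1 = 0 := by
    have : s * v.1 = 0 := by linarith
    exact (mul_eq_zero.1 this).resolve_left hs0
  rw [hv0] at ht1
  apply h2
  linarith

end final

end RoofPf

/-- **Property 2.** Let `K` be a TrV triangulated 2-disk with roof `T`
and `F` a vertical simplexwise linear embedding of `∂K` with convex image. If a
spanning edge `{a,b}` is `F`-obstructive and `pos a` lies in `T ∖ ∂T` (i.e. `T` is a
neighborhood of `pos a` within `∂K`), then `pos b` also lies in `T`. -/
theorem obstructive_edge_other_endpoint_in_roof
    {ι : Type} [Fintype ι] [DecidableEq ι]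
    (D : TriDisk ι) (hTrV : D.TrV)
    (F : ℝ × ℝ → ℝ × ℝ)
    (hSL : D.SLOnBoundary F)
    (hinj : Set.InjOn F (frontier D.space))
    (hvert : TriDisk.VerticalOn F (frontier D.space))
    (hconv : D.ConvexImage F)
    (a b : ι)
    (hobs : D.Obstructive F a b)
    (ha : D.pos a ∈ D.roof ∧ D.roof ∈ nhdsWithin (D.pos a) (frontier D.space)) :
    D.pos b ∈ D.roof := by
  obtain ⟨C, hC, hCc, hCi, hF⟩ := hconv
  obtain ⟨m, M, l, u, h⟩ := RoofPf.exists_reg (RoofPf.space_compact D) (RoofPf.space_reg D) hTrV F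
    hinj hvert hC hCc hCi hF
  obtain ⟨⟨-, haf, hbf, -⟩, x, hx, hcol⟩ := hobs
  by_contra hb
  obtain ⟨har, han⟩ := ha
  generalize D.pos a = pa at *
  generalize D.pos b = pb at *
  obtain ⟨xa, ya⟩ := pa
  obtain ⟨β, yb⟩ := pb
  have hβ : (m < β ∧ β < M) ∧ yb = l β := by
    rcases (h.fr _ _).1 hbf with ⟨h1, h2 | h2⟩ | ⟨h1, h2⟩
    · exact ⟨h1, h2⟩
    · subst h2; exact absurd (RoofPf.upper_roof h h1) hb
    · exact absurd (RoofPf.side_roof h h1 h2) hb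
  obtain ⟨hβ, rfl⟩ := hβ
  have hsp := h.split haf hβ ?_ ?_ ?_
  · obtain ⟨P, Q, hP, hQ, bP, bQ, hPQ⟩ := hsp
    have hclos : ∀ y, closure (connectedComponentIn
        (frontier D.space \ {(xa, ya), (β, l β)}) y) ⊆ frontier D.space := fun y =>
      closure_minimal ((connectedComponentIn_subset _ _).trans Set.diff_subset) isClosed_frontier
    have key : ∀ R : Set (ℝ × ℝ), IsPreconnected R → RoofPf.Bad R →
        R ⊆ frontier D.space \ {(xa, ya), (β, l β)} → x ∈ R → False := by
      intro R h1 h2 h3 h4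
      have h5 := (h1.subset_connectedComponentIn h4 h3).trans subset_closure
      exact RoofPf.bad_not_collinear hinj hvert (h5.trans (hclos x)) h2
        (hcol.subset (Set.image_mono h5))
    rw [← hPQ] at hx
    rcases hx with hx | hx
    · exact key P hP bP (hPQ ▸ Set.subset_union_left) hx
    · exact key Q hQ bQ (hPQ ▸ Set.subset_union_right) hx
  · intro h1 h2
    rcases (h.fr _ _).1 haf with ⟨h3, h4 | h4⟩ | ⟨h3 | h3, -⟩
    · subst h4; exact absurd har (RoofPf.lower_not_roof h h3)
    · exact h4
    · linarith
    · linarith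
  · rintro rfl
    rcases (h.fr _ _).1 haf with ⟨h3, -⟩ | ⟨-, h3, -⟩
    · exact absurd h3.1 (lt_irrefl _)
    refine lt_of_le_of_ne h3 ?_
    rintro rfl
    exact RoofPf.not_nhds h (h.clm h.lt) han
  · rintro rfl
    rcases (h.fr _ _).1 haf with ⟨h3, -⟩ | ⟨-, h3, -⟩
    · exact absurd h3.2 (lt_irrefl _)
    refine lt_of_le_of_ne h3 ?_
    rintro rfl
    exact RoofPf.not_nhds h (h.clM h.lt) han
end

section
/- Let K be a triangulated 2-disk in ℝ², f : ∂K → ℝ² a simplexwise-linear embedding with convex image, and σ a spanning edge of K dividing K into K₁ and K₂, with σ not f-obstructive. Then for i = 1, 2, the map f_i : ∂K_i → ℝ² defined by f on ∂K_i ∩ ∂K and by the straight segment joining f of the endpoints of σ on σ, is an embedding with convex image; moreover if K has no f-obstructive spanning edge, then K_i has no f_i-obstructive spanning edge. -/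
namespace IndEmb

open Set Topology

/-- Orientation functional of the line through `p` and `q`. -/
def cr (p q x : ℝ × ℝ) : ℝ := (q.1 - p.1) * (x.2 - p.2) - (q.2 - p.2) * (x.1 - p.1)

lemma cr_cont (p q : ℝ × ℝ) : Continuous (cr p q) := by
  unfold cr; fun_prop

lemma cr_swap (p q x : ℝ × ℝ) : cr q p x = - cr p q x := by
  unfold cr; ring

lemma cr_combo (p q x y : ℝ × ℝ) (s t : ℝ) (h : s + t = 1) :
    cr p q (s • x + t • y) = s * cr p q x + t * cr p q y := by
  have : s = 1 - t := by linarith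
  subst this
  simp only [cr, Prod.fst_add, Prod.snd_add, Prod.smul_fst, Prod.smul_snd, smul_eq_mul]; ring

lemma cr_left (p q : ℝ × ℝ) : cr p q p = 0 := by unfold cr; ring

lemma cr_right (p q : ℝ × ℝ) : cr p q q = 0 := by unfold cr; ring

lemma cr_zero {p q x : ℝ × ℝ} (hpq : p ≠ q) (h : cr p q x = 0) :
    ∃ t : ℝ, x = (1 - t) • p + t • q := by
  by_cases h1 : q.1 - p.1 = 0
  · have h2 : q.2 - p.2 ≠ 0 := by
      intro h2
      exact hpq (Prod.ext (by linarith) (by linarith))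
    refine ⟨(x.2 - p.2) / (q.2 - p.2), ?_⟩
    have h3 : x.1 - p.1 = 0 := by
      unfold cr at h
      rw [h1] at h
      have : (q.2 - p.2) * (x.1 - p.1) = 0 := by linarith
      exact (mul_eq_zero.1 this).resolve_left h2
    ext
    · simp only [Prod.fst_add, Prod.smul_fst, smul_eq_mul]
      have : q.1 = p.1 := by linarith
      rw [this]; linarith
    · simp only [Prod.snd_add, Prod.smul_snd, smul_eq_mul]
      field_simp; ring
  · refine ⟨(x.1 - p.1) / (q.1 - p.1), ?_⟩
    unfold cr at h
    ext
    · simp only [Prod.fst_add, Prod.smul_fst, smul_eq_mul]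
      field_simp; ring
    · simp only [Prod.snd_add, Prod.smul_snd, smul_eq_mul]
      field_simp; linarith

lemma openSeg_int {C : Set (ℝ × ℝ)} (hC : Convex ℝ C) {p q z : ℝ × ℝ} (hp : p ∈ C) (hq : q ∈ C)
    (hz : z ∈ openSegment ℝ p q) (hzi : z ∈ interior C) : openSegment ℝ p q ⊆ interior C := by
  intro w hw
  have hins : w ∈ insert z (openSegment ℝ p z ∪ openSegment ℝ z q) := by
    apply openSegment_subset_union p q _ hw
    obtain ⟨s, t, hs, ht, hst, rfl⟩ := hz
    refine ⟨t, ?_⟩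
    simp only [AffineMap.lineMap_apply_module]
    rw [← hst]; simp
  rcases hins with rfl | h | h
  · exact hzi
  · exact hC.openSegment_closure_interior_subset_interior (subset_closure hp) hzi h
  · exact hC.openSegment_interior_closure_subset_interior hzi (subset_closure hq) h

lemma chord_line {C : Set (ℝ × ℝ)} (hC : Convex ℝ C) (hcl : IsClosed C) {p q x : ℝ × ℝ}
    (hpq : p ≠ q) (hp : p ∈ frontier C) (hq : q ∈ frontier C)
    (hint : openSegment ℝ p q ⊆ interior C) (hx : x ∈ C) (h0 : cr p q x = 0) :
    x ∈ segment ℝ p q := by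
  obtain ⟨t, rfl⟩ := cr_zero hpq h0
  have key : ∀ (p q : ℝ × ℝ), p ∈ frontier C → openSegment ℝ p q ⊆ interior C → ∀ t : ℝ,
      (1 - t) • p + t • q ∈ C → 0 ≤ t := by
    intro p q hp hint t hx
    by_contra ht
    push Not at ht
    have hm : (1/2 : ℝ) • p + (1/2 : ℝ) • q ∈ interior C :=
      hint ⟨1/2, 1/2, by norm_num, by norm_num, by norm_num, rfl⟩
    have : p ∈ interior C := by
      apply hC.openSegment_interior_self_subset_interior hm hx
      have hd : 0 < 1 - 2 * t := by linarith
      have hd' := hd.ne'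
      refine ⟨(-2 * t) / (1 - 2 * t), 1 / (1 - 2 * t), by apply div_pos <;> linarith, by positivity,
        by field_simp; ring, ?_⟩
      ext <;> simp only [Prod.fst_add, Prod.snd_add, Prod.smul_fst, Prod.smul_snd, smul_eq_mul] <;>
        field_simp <;> ring
    exact hp.2 this
  have h1 := key p q hp hint t hx
  have h2 := key q p hq (by rwa [openSegment_symm]) (1 - t) (by
    convert hx using 1
    rw [add_comm]; simp)
  exact ⟨1 - t, t, h2, h1, by ring, rfl⟩

lemma mem_seg_cases {p q x : ℝ × ℝ} (h : x ∈ segment ℝ p q) :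
    x = p ∨ x = q ∨ x ∈ openSegment ℝ p q := by
  have := insert_endpoints_openSegment ℝ p q
  rw [← this] at h
  simpa using h

lemma chord_frontier {C : Set (ℝ × ℝ)} (hC : Convex ℝ C) (hcl : IsClosed C) {p q x : ℝ × ℝ}
    (hpq : p ≠ q) (hp : p ∈ frontier C) (hq : q ∈ frontier C)
    (hint : openSegment ℝ p q ⊆ interior C) (hx : x ∈ frontier C) (h0 : cr p q x = 0) :
    x = p ∨ x = q := by
  rcases mem_seg_cases (chord_line hC hcl hpq hp hq hint (hcl.frontier_subset hx) h0) with h | h | h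
  · exact Or.inl h
  · exact Or.inr h
  · exact absurd (hint h) hx.2

/-- The positive open arc cut by a chord is an image of a half plane. -/
lemma arc_aux {C : Set (ℝ × ℝ)} (hC : Convex ℝ C) (hco : IsCompact C) {p q : ℝ × ℝ}
    (hpq : p ≠ q) (hp : p ∈ frontier C) (hq : q ∈ frontier C)
    (hint : openSegment ℝ p q ⊆ interior C) :
    IsPreconnected (frontier C ∩ {x | 0 < cr p q x}) ∧ p ∈ closure (frontier C ∩ {x | 0 < cr p q x})
      ∧ q ∈ closure (frontier C ∩ {x | 0 < cr p q x}) := by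
  set m : ℝ × ℝ := (1/2 : ℝ) • p + (1/2 : ℝ) • q with hm
  have hmi : m ∈ interior C := hint ⟨1/2, 1/2, by norm_num, by norm_num, by norm_num, rfl⟩
  set h := Homeomorph.addLeft m with hh
  set B : Set (ℝ × ℝ) := h ⁻¹' C with hB
  have hBconv : Convex ℝ B := by
    have := hC.translate_preimage_right m
    simpa [hB, hh] using this
  have hBn : B ∈ 𝓝 (0 : ℝ × ℝ) := by
    apply h.continuous.continuousAt.preimage_mem_nhds
    simpa [hh] using mem_interior_iff_mem_nhds.1 hmi
  have hBco : IsCompact B := h.isCompact_preimage.2 hco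
  have hfr : ∀ u, u ∈ frontier B ↔ m + u ∈ frontier C := by
    intro u
    rw [hB, ← h.preimage_frontier]; rfl
  have hg := continuous_gauge hBconv hBn
  have hgpos : ∀ u : ℝ × ℝ, u ≠ 0 → 0 < gauge B u := fun u hu =>
    (gauge_pos (absorbent_nhds_zero hBn) (NormedSpace.isVonNBounded_of_isBounded ℝ hBco.isBounded)).2 hu
  set r : ℝ × ℝ → ℝ × ℝ := fun u => m + (gauge B u)⁻¹ • u with hr
  have hrc : ∀ u, u ≠ 0 → ContinuousAt r u := by
    intro u hu
    exact continuousAt_const.add ((hg.continuousAt.inv₀ (hgpos u hu).ne').smul continuousAt_id)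
  have hrf : ∀ u, u ≠ 0 → r u ∈ frontier C := by
    intro u hu
    rw [← hfr, ← gauge_eq_one_iff_mem_frontier hBconv hBn,
      gauge_smul_of_nonneg (inv_nonneg.2 (hgpos u hu).le), smul_eq_mul,
      inv_mul_cancel₀ (hgpos u hu).ne']
  have hr1 : ∀ x ∈ frontier C, r (x - m) = x := by
    intro x hx
    have : gauge B (x - m) = 1 := by
      rw [gauge_eq_one_iff_mem_frontier hBconv hBn, hfr]; simpa using hx
    simp [hr, this]
  set H : Set (ℝ × ℝ) := {u | 0 < cr p q (m + u)} with hH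
  have hcrm : ∀ (s : ℝ) u, cr p q (m + s • u) = s * cr p q (m + u) := by
    intro s u
    simp only [hm, cr, Prod.fst_add, Prod.snd_add, Prod.smul_fst, Prod.smul_snd, smul_eq_mul]; ring
  have hcr0 : cr p q m = 0 := by simpa using hcrm 0 0
  have hH0 : ∀ u ∈ H, u ≠ 0 := by
    rintro u hu rfl
    simp [hH, hcr0] at hu
  have hHc : Convex ℝ H := by
    intro x hx y hy s t hs ht hst
    have : m + (s • x + t • y) = s • (m + x) + t • (m + y) := by
      have : s = 1 - t := by linarith
      subst this
      module
    simp only [hH, mem_ofPred_eq] at hx hy ⊢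
    rw [this, cr_combo _ _ _ _ _ _ hst]
    rcases hs.eq_or_lt with rfl | hs
    · have : t = 1 := by linarith
      subst this; simpa using hy
    · have := mul_pos hs hx
      have := mul_nonneg ht hy.le
      linarith
  have himg : r '' H = frontier C ∩ {x | 0 < cr p q x} := by
    ext x; constructor
    · rintro ⟨u, hu, rfl⟩
      refine ⟨hrf u (hH0 u hu), ?_⟩
      simp only [hr, mem_ofPred_eq, hcrm]
      exact mul_pos (inv_pos.2 (hgpos u (hH0 u hu))) hu
    · rintro ⟨hx, hx2⟩
      exact ⟨x - m, by simpa [hH] using hx2, hr1 x hx⟩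
  -- endpoints
  have hend : ∀ x ∈ frontier C, cr p q x = 0 → x ∈ closure (frontier C ∩ {x | 0 < cr p q x}) := by
    intro x hx hx0
    have hne : x - m ≠ 0 := by
      intro h0
      have : x = m := sub_eq_zero.1 h0
      exact hx.2 (this ▸ hmi)
    rw [← himg, ← hr1 x hx]
    have hcl : x - m ∈ closure H := by
      -- direction n
      set n : ℝ × ℝ := (-(q.2 - p.2), q.1 - p.1) with hn
      have hpos : 0 < (q.1 - p.1)^2 + (q.2 - p.2)^2 := by
        by_contra hle
        have h1 : q.1 - p.1 = 0 := by nlinarith [sq_nonneg (q.1 - p.1), sq_nonneg (q.2 - p.2)]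
        have h2 : q.2 - p.2 = 0 := by nlinarith [sq_nonneg (q.1 - p.1), sq_nonneg (q.2 - p.2)]
        exact hpq (Prod.ext (by linarith) (by linarith))
      have ht : Filter.Tendsto (fun s : ℝ => (x - m) + s • n) (𝓝[>] 0) (𝓝 (x - m)) := by
        have : Continuous (fun s : ℝ => (x - m) + s • n) := by fun_prop
        have := this.tendsto 0
        simp only [zero_smul, add_zero] at this
        exact this.mono_left nhdsWithin_le_nhds
      refine mem_closure_of_tendsto ht ?_
      filter_upwards [self_mem_nhdsWithin] with s hs
      have e : cr p q (m + (x - m + s • n)) = cr p q x + s * ((q.1 - p.1)^2 + (q.2 - p.2)^2) := by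
        simp only [hn, cr, Prod.fst_add, Prod.snd_add, Prod.smul_fst, Prod.smul_snd, smul_eq_mul,
          Prod.fst_sub, Prod.snd_sub]; ring
      simp only [hH, mem_ofPred_eq, e, hx0, zero_add]
      exact mul_pos hs hpos
    exact map_mem_closure_of_continuousAt hcl (hrc _ hne)
  refine ⟨?_, hend p hp (cr_left p q), hend q hq (cr_right p q)⟩
  rw [← himg]
  exact hHc.isPreconnected.image r (fun u hu => (hrc u (hH0 u hu)).continuousWithinAt)
where
  map_mem_closure_of_continuousAt {r : ℝ × ℝ → ℝ × ℝ} {H : Set (ℝ × ℝ)} {u : ℝ × ℝ}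
      (hu : u ∈ closure H) (hr : ContinuousAt r u) : r u ∈ closure (r '' H) := by
    exact hr.continuousWithinAt.mem_closure_image hu

lemma ray_unique {C : Set (ℝ × ℝ)} (hC : Convex ℝ C) (hcl : IsClosed C) {o q x : ℝ × ℝ}
    (ho : o ∈ interior C) (hq : q ∈ frontier C) (hx : x ∈ frontier C) {β : ℝ} (hβ : 0 ≤ β)
    (h : x = (1 - β) • o + β • q) : x = q := by
  rcases lt_trichotomy β 1 with h1 | h1 | h1
  · exfalso
    apply hx.2
    rw [h]
    exact hC.combo_interior_self_mem_interior ho (hcl.frontier_subset hq) (by linarith) hβ (by ring)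
  · subst h1; simpa using h
  · exfalso
    apply hq.2
    have hb : 0 < β := by linarith
    have : q = (1 - 1 / β) • o + (1 / β) • x := by
      rw [h]
      ext <;> simp only [Prod.fst_add, Prod.snd_add, Prod.smul_fst, Prod.smul_snd, smul_eq_mul] <;>
        field_simp <;> ring
    rw [this]
    refine hC.combo_interior_self_mem_interior ho (hcl.frontier_subset hx) ?_ (by positivity)
      (by ring)
    have : 1 / β < 1 := by rw [div_lt_one hb]; exact h1
    linarith

lemma flat_component {C : Set (ℝ × ℝ)} (hC : Convex ℝ C) (hcl : IsClosed C)
    (hne : (interior C).Nonempty) {p q : ℝ × ℝ} (hpq : p ≠ q)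
    (hp : p ∈ frontier C) (hq : q ∈ frontier C) {V : Set (ℝ × ℝ)} (hV : IsPreconnected V)
    (hVs : V ⊆ frontier C \ {p, q}) {z : ℝ × ℝ} (hzV : z ∈ V) (hz : z ∈ openSegment ℝ p q) :
    V ⊆ openSegment ℝ p q := by
  obtain ⟨o, ho⟩ := hne
  have hpC := hcl.frontier_subset hp
  have hqC := hcl.frontier_subset hq
  have hno : ∀ w ∈ openSegment ℝ p q, w ∈ frontier C := by
    intro w hw
    refine ⟨subset_closure (hC.openSegment_subset hpC hqC hw), fun hwi => ?_⟩
    exact (hVs hzV).1.2 (openSeg_int hC hpC hqC hw hwi hz)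
  have hm : (1/2 : ℝ) • p + (1/2 : ℝ) • q ∈ frontier C :=
      hno _ ⟨1/2, 1/2, by norm_num, by norm_num, by norm_num, rfl⟩
  have hD : cr o p q ≠ 0 := by
    intro h0
    have h0' : cr p q o = 0 := by
      have : cr p q o = cr o p q := by unfold cr; ring
      rw [this, h0]
    obtain ⟨t, ht⟩ := cr_zero hpq h0'
    apply hm.2
    rcases le_total t (1/2) with h | h
    · have hd : 0 < 1 - t := by linarith
      have hd' := hd.ne'
      have : (1/2 : ℝ) • p + (1/2 : ℝ) • q = (1 / (2 * (1 - t))) • o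
          + (1 - 1 / (2 * (1 - t))) • q := by
        rw [ht]
        ext <;> simp only [Prod.fst_add, Prod.snd_add, Prod.smul_fst, Prod.smul_snd, smul_eq_mul] <;>
          field_simp <;> ring
      rw [this]
      refine hC.combo_interior_self_mem_interior ho hqC (by positivity) ?_ (by ring)
      have : 1 / (2 * (1 - t)) ≤ 1 := by rw [div_le_one (by positivity)]; linarith
      linarith
    · have hd : 0 < t := by linarith
      have : (1/2 : ℝ) • p + (1/2 : ℝ) • q = (1 / (2 * t)) • o
          + (1 - 1 / (2 * t)) • p := by
        rw [ht]
        ext <;> simp only [Prod.fst_add, Prod.snd_add, Prod.smul_fst, Prod.smul_snd, smul_eq_mul] <;>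
          field_simp <;> ring
      rw [this]
      refine hC.combo_interior_self_mem_interior ho hpC (by positivity) ?_ (by ring)
      have : 1 / (2 * t) ≤ 1 := by rw [div_le_one (by positivity)]; linarith
      linarith
  have hD' : cr o q p = - cr o p q := by unfold cr; ring
  set α : ℝ × ℝ → ℝ := fun x => - cr o q x / cr o p q with hα
  set β : ℝ × ℝ → ℝ := fun x => cr o p x / cr o p q with hβ
  have hαc : Continuous α := by
    have := cr_cont o q
    simp only [hα]; fun_prop
  have hβc : Continuous β := by
    have := cr_cont o p
    simp only [hβ]; fun_prop
  have hdec : ∀ x, x = (1 - α x - β x) • o + α x • p + β x • q := by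
    intro x
    have h1 : α x * cr o p q = - cr o q x := by simp only [hα]; field_simp
    have h2 : β x * cr o p q = cr o p x := by simp only [hβ]; field_simp
    unfold cr at h1 h2 hD
    generalize α x = A at *
    generalize β x = B at *
    ext <;> simp only [Prod.fst_add, Prod.snd_add, Prod.smul_fst, Prod.smul_snd, smul_eq_mul] <;>
      apply mul_left_cancel₀ hD
    · linear_combination (-(p.1 - o.1)) * h1 - (q.1 - o.1) * h2
    · linear_combination (-(p.2 - o.2)) * h1 - (q.2 - o.2) * h2
  set U : Set (ℝ × ℝ) := {x | 0 < α x ∧ 0 < β x} with hU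
  set U' : Set (ℝ × ℝ) := {x | α x < 0 ∨ β x < 0} with hU'
  have hUo : IsOpen U := (isOpen_lt continuous_const hαc).inter (isOpen_lt continuous_const hβc)
  have hUo' : IsOpen U' := (isOpen_lt hαc continuous_const).union (isOpen_lt hβc continuous_const)
  have hdis : Disjoint U U' := by
    rw [Set.disjoint_left]
    rintro x ⟨h1, h2⟩ (h | h) <;> linarith
  have hcov : V ⊆ U ∪ U' := by
    intro x hx
    by_contra hn
    have hn1 : x ∉ U := fun h => hn (Or.inl h)
    have hn2 : x ∉ U' := fun h => hn (Or.inr h)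
    simp only [hU', mem_ofPred_eq, not_or, not_lt] at hn2
    simp only [hU, mem_ofPred_eq, not_and_or, not_lt] at hn1
    have hxV := hVs hx
    rcases hn1 with h | h
    · have h0 : α x = 0 := le_antisymm h hn2.1
      have e := hdec x
      rw [h0] at e
      have := ray_unique hC hcl ho hq hxV.1 hn2.2 (by simpa using e)
      exact hxV.2 (by simp [this])
    · have h0 : β x = 0 := le_antisymm h hn2.2
      have e := hdec x
      rw [h0] at e
      have := ray_unique hC hcl ho hp hxV.1 hn2.1 (by simpa using e)
      exact hxV.2 (by simp [this])
  have hzU : z ∈ U := by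
    obtain ⟨s, t, hs, ht, hst, rfl⟩ := hz
    simp only [hU, hα, hβ, mem_ofPred_eq, cr_combo _ _ _ _ _ _ hst, cr_right, hD']
    constructor
    · have : -(s * -cr o p q + t * 0) / cr o p q = s := by field_simp; ring
      rw [this]; exact hs
    · have : (s * 0 + t * cr o p q) / cr o p q = t := by field_simp; ring
      rw [this]; exact ht
  have hVU : V ⊆ U := hV.subset_left_of_subset_union hUo hUo' hdis hcov ⟨z, hzV, hzU⟩
  intro x hx
  obtain ⟨h1, h2⟩ := hVU hx
  have hs : 0 < α x + β x := by linarith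
  have hy : (α x / (α x + β x)) • p + (β x / (α x + β x)) • q ∈ openSegment ℝ p q :=
    ⟨_, _, by positivity, by positivity, by field_simp, rfl⟩
  have : x = (α x / (α x + β x)) • p + (β x / (α x + β x)) • q := by
    refine ray_unique hC hcl ho (hno _ hy) (hVs hx).1 hs.le ?_
    conv_lhs => rw [hdec x]
    generalize α x = A at *
    generalize β x = B at *
    ext <;> simp only [Prod.fst_add, Prod.snd_add, Prod.smul_fst, Prod.smul_snd, smul_eq_mul] <;>
      field_simp <;> ring
  rw [this]; exact hy

lemma collinear_segment (p q : ℝ × ℝ) : Collinear ℝ (segment ℝ p q) := by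
  rw [collinear_iff_exists_forall_eq_smul_vadd]
  refine ⟨p, q - p, ?_⟩
  rintro x ⟨s, t, hs, ht, hst, rfl⟩
  refine ⟨t, ?_⟩
  have : s = 1 - t := by linarith
  subst this
  simp only [vadd_eq_add]; module

lemma cr_of_collinear {S : Set (ℝ × ℝ)} (h : Collinear ℝ S) {p q x : ℝ × ℝ} (hp : p ∈ S)
    (hq : q ∈ S) (hx : x ∈ S) : cr p q x = 0 := by
  rw [collinear_iff_exists_forall_eq_smul_vadd] at h
  obtain ⟨p0, v, h⟩ := h
  obtain ⟨a, rfl⟩ := h p hp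
  obtain ⟨b, rfl⟩ := h q hq
  obtain ⟨c, rfl⟩ := h x hx
  simp only [vadd_eq_add, cr, Prod.fst_add, Prod.snd_add, Prod.smul_fst, Prod.smul_snd, smul_eq_mul]
  ring

lemma closure_comp_subset {S : Set (ℝ × ℝ)} (hS : IsClosed S) (T : Set (ℝ × ℝ)) (x : ℝ × ℝ) :
    closure (connectedComponentIn (S \ T) x) ⊆ S :=
  closure_minimal ((connectedComponentIn_subset _ _).trans sdiff_subset) hS

lemma obstr_of_meet {S : Set (ℝ × ℝ)} (hS : IsCompact S) {F : ℝ × ℝ → ℝ × ℝ}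
    (hF : ContinuousOn F S) (hinj : InjOn F S) {C : Set (ℝ × ℝ)} (hC : Convex ℝ C)
    (hcl : IsClosed C) (hne : (interior C).Nonempty) (him : F '' S = frontier C)
    {u v : ℝ × ℝ} (hu : u ∈ S) (hv : v ∈ S) (huv : u ≠ v) {z : ℝ × ℝ}
    (hz : z ∈ openSegment ℝ (F u) (F v)) (hzf : z ∈ frontier C) :
    ∃ x ∈ S \ {u, v}, Collinear ℝ (F '' closure (connectedComponentIn (S \ {u, v}) x)) := by
  have hFuv : F u ≠ F v := fun h => huv (hinj hu hv h)
  obtain ⟨x, hxS, rfl⟩ : z ∈ F '' S := him ▸ hzf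
  have hx : x ∈ S \ {u, v} := by
    refine ⟨hxS, ?_⟩
    rintro (rfl | h)
    · exact hFuv ((left_mem_openSegment_iff).1 hz)
    · rw [mem_singleton_iff] at h
      subst h
      exact hFuv ((right_mem_openSegment_iff).1 hz)
  refine ⟨x, hx, ?_⟩
  set K := connectedComponentIn (S \ {u, v}) x with hK
  have hKS : K ⊆ S \ {u, v} := connectedComponentIn_subset _ _
  have hV : F '' K ⊆ openSegment ℝ (F u) (F v) := by
    refine flat_component hC hcl hne hFuv (him ▸ mem_image_of_mem F hu)
      (him ▸ mem_image_of_mem F hv)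
      (isPreconnected_connectedComponentIn.image F (hF.mono (hKS.trans sdiff_subset))) ?_
      (mem_image_of_mem F (mem_connectedComponentIn hx)) hz
    rintro _ ⟨y, hy, rfl⟩
    refine ⟨him ▸ mem_image_of_mem F (hKS hy).1, ?_⟩
    rintro (h | h)
    · exact (hKS hy).2 (by simp [hinj (hKS hy).1 hu h])
    · exact (hKS hy).2 (by simp [hinj (hKS hy).1 hv h])
  refine (collinear_segment (F u) (F v)).subset ?_
  have h1 : F '' closure K ⊆ closure (F '' K) :=
    ContinuousOn.image_closure (hF.mono (closure_comp_subset hS.isClosed _ _))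
  refine h1.trans (closure_minimal (hV.trans (openSegment_subset_segment ℝ _ _)) ?_)
  rw [segment_eq_image]
  exact (isCompact_Icc.image (by fun_prop)).isClosed

lemma preconn_preimage {S : Set (ℝ × ℝ)} (hS : IsCompact S) {F : ℝ × ℝ → ℝ × ℝ}
    (hF : ContinuousOn F S) (hinj : InjOn F S) {T : Set (ℝ × ℝ)} (hT : IsPreconnected T)
    (hTs : T ⊆ F '' S) : IsPreconnected (S ∩ F ⁻¹' T) := by
  rw [isPreconnected_closed_iff]
  rintro A B hA hB hcov ⟨x, ⟨hxS, hxT⟩, hxA⟩ ⟨y, ⟨hyS, hyT⟩, hyB⟩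
  have cl : ∀ A : Set (ℝ × ℝ), IsClosed A → IsClosed (F '' (S ∩ A)) := fun A hA =>
    ((hS.inter_right hA).image_of_continuousOn (hF.mono inter_subset_left)).isClosed
  obtain ⟨w, hwT, ⟨a, ⟨haS, haA⟩, rfl⟩, ⟨b, ⟨hbS, hbB⟩, hab⟩⟩ :=
    isPreconnected_closed_iff.1 hT _ _ (cl A hA) (cl B hB)
      (by
        intro w hw
        obtain ⟨s, hs, rfl⟩ := hTs hw
        rcases hcov ⟨hs, hw⟩ with h | h
        · exact Or.inl ⟨s, ⟨hs, h⟩, rfl⟩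
        · exact Or.inr ⟨s, ⟨hs, h⟩, rfl⟩)
      ⟨F x, hxT, x, ⟨hxS, hxA⟩, rfl⟩ ⟨F y, hyT, y, ⟨hyS, hyB⟩, rfl⟩
  have : b = a := hinj hbS haS hab
  subst this
  exact ⟨b, ⟨haS, hwT⟩, haA, hbB⟩

lemma not_obstr_of_interior {S : Set (ℝ × ℝ)} (hS : IsCompact S) {F : ℝ × ℝ → ℝ × ℝ}
    (hF : ContinuousOn F S) (hinj : InjOn F S) {C : Set (ℝ × ℝ)} (hC : Convex ℝ C)
    (hco : IsCompact C) (him : F '' S = frontier C)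
    {u v : ℝ × ℝ} (hu : u ∈ S) (hv : v ∈ S) (huv : u ≠ v)
    (hint : openSegment ℝ (F u) (F v) ⊆ interior C) {x : ℝ × ℝ} (hx : x ∈ S \ {u, v}) :
    ¬ Collinear ℝ (F '' closure (connectedComponentIn (S \ {u, v}) x)) := by
  intro hcol
  have hFuv : F u ≠ F v := fun h => huv (hinj hu hv h)
  have hfu : F u ∈ frontier C := him ▸ mem_image_of_mem F hu
  have hfv : F v ∈ frontier C := him ▸ mem_image_of_mem F hv
  have hfx : F x ∈ frontier C := him ▸ mem_image_of_mem F hx.1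
  have key : ∀ p q, p ≠ q → p ∈ frontier C → q ∈ frontier C → openSegment ℝ p q ⊆ interior C →
      0 < cr p q (F x) → cr p q (F u) = 0 → cr p q (F v) = 0 →
      p ∈ F '' closure (connectedComponentIn (S \ {u, v}) x) ∧
      q ∈ F '' closure (connectedComponentIn (S \ {u, v}) x) := by
    intro p q hpq hp hq hpqi hpos hu0 hv0
    obtain ⟨h1, h2, h3⟩ := arc_aux hC hco hpq hp hq hpqi
    set T := frontier C ∩ {x | 0 < cr p q x} with hT
    have hpre := preconn_preimage hS hF hinj h1 (by rw [him]; exact inter_subset_left)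
    have hsub : S ∩ F ⁻¹' T ⊆ connectedComponentIn (S \ {u, v}) x := by
      refine hpre.subset_connectedComponentIn ⟨hx.1, hfx, hpos⟩ ?_
      rintro y ⟨hyS, hy1, hy2⟩
      refine ⟨hyS, ?_⟩
      simp only [mem_ofPred_eq] at hy2
      rintro (rfl | h)
      · linarith
      · rw [mem_singleton_iff] at h
        subst h; linarith
    have hTF : closure T ⊆ F '' closure (connectedComponentIn (S \ {u, v}) x) := by
      apply closure_minimal
      · rintro y hy
        obtain ⟨s, hs, rfl⟩ : y ∈ F '' S := him ▸ hy.1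
        exact ⟨s, subset_closure (hsub ⟨hs, hy⟩), rfl⟩
      · have hcs := closure_comp_subset hS.isClosed {u, v} x
        exact ((hS.of_isClosed_subset isClosed_closure hcs).image_of_continuousOn
          (hF.mono hcs)).isClosed
    exact ⟨hTF h2, hTF h3⟩
  have hxmem : F x ∈ F '' closure (connectedComponentIn (S \ {u, v}) x) :=
    mem_image_of_mem F (subset_closure (mem_connectedComponentIn hx))
  rcases lt_trichotomy (cr (F u) (F v) (F x)) 0 with h | h | h
  · have h' : 0 < cr (F v) (F u) (F x) := by rw [cr_swap]; linarith
    obtain ⟨h1, h2⟩ := key (F v) (F u) hFuv.symm hfv hfu (by rwa [openSegment_symm]) h'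
      (cr_right _ _) (cr_left _ _)
    have := cr_of_collinear hcol h1 h2 hxmem
    linarith
  · rcases chord_frontier hC hco.isClosed hFuv hfu hfv hint hfx h with h | h
    · exact hx.2 (by simp [hinj hx.1 hu h])
    · exact hx.2 (by simp [hinj hx.1 hv h])
  · obtain ⟨h1, h2⟩ := key (F u) (F v) hFuv hfu hfv hint h (cr_left _ _) (cr_right _ _)
    have := cr_of_collinear hcol h1 h2 hxmem
    linarith

lemma half_convex {C : Set (ℝ × ℝ)} (hC : Convex ℝ C) (p q : ℝ × ℝ) :
    Convex ℝ (C ∩ {x | 0 ≤ cr p q x}) := by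
  refine hC.inter ?_
  intro x hx y hy s t hs ht hst
  simp only [mem_ofPred_eq] at hx hy ⊢
  rw [cr_combo _ _ _ _ _ _ hst]
  positivity

lemma cr_dir {p q : ℝ × ℝ} (hpq : p ≠ q) : ∃ n : ℝ × ℝ, ∃ c : ℝ, 0 < c ∧
    ∀ x (s : ℝ), cr p q (x + s • n) = cr p q x + s * c := by
  refine ⟨(-(q.2 - p.2), q.1 - p.1), (q.1 - p.1)^2 + (q.2 - p.2)^2, ?_, ?_⟩
  · by_contra hle
    have h1 : q.1 - p.1 = 0 := by nlinarith [sq_nonneg (q.1 - p.1), sq_nonneg (q.2 - p.2)]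
    have h2 : q.2 - p.2 = 0 := by nlinarith [sq_nonneg (q.1 - p.1), sq_nonneg (q.2 - p.2)]
    exact hpq (Prod.ext (by linarith) (by linarith))
  · intro x s
    simp only [cr, Prod.fst_add, Prod.snd_add, Prod.smul_fst, Prod.smul_snd, smul_eq_mul]; ring

/-- Moving off the line `cr = c` from any point, in either direction. -/
lemma exists_near {p q : ℝ × ℝ} (hpq : p ≠ q) {U : Set (ℝ × ℝ)} (hU : IsOpen U) {x : ℝ × ℝ}
    (hx : x ∈ U) : (∃ y ∈ U, cr p q x < cr p q y) ∧ ∃ y ∈ U, cr p q y < cr p q x := by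
  obtain ⟨n, c, hc, hn⟩ := cr_dir hpq
  have hcont : Continuous (fun s : ℝ => x + s • n) := by fun_prop
  have h0 : ∀ᶠ s in 𝓝 (0 : ℝ), x + s • n ∈ U := by
    apply hcont.continuousAt.eventually_mem
    simpa using hU.mem_nhds hx
  obtain ⟨e, he, hball⟩ := Metric.eventually_nhds_iff.1 h0
  constructor
  · refine ⟨x + (e/2) • n, hball (by simp [abs_of_pos he, he]), ?_⟩
    rw [hn]; nlinarith
  · refine ⟨x + (-(e/2)) • n, hball (by simp [abs_of_pos he, he]), ?_⟩
    rw [hn]; nlinarith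

lemma half_interior {C : Set (ℝ × ℝ)} {p q : ℝ × ℝ} (hpq : p ≠ q) :
    interior (C ∩ {x | 0 ≤ cr p q x}) = interior C ∩ {x | 0 < cr p q x} := by
  rw [interior_inter]
  congr 1
  apply Subset.antisymm
  · intro x hx
    obtain ⟨y, hy, hlt⟩ := (exists_near hpq isOpen_interior hx).2
    have hy' : y ∈ {x | 0 ≤ cr p q x} := interior_subset hy
    have : 0 ≤ cr p q y := hy'
    exact lt_of_le_of_lt this hlt
  · apply interior_maximal
    · intro x hx
      have hx' : 0 < cr p q x := hx
      exact hx'.le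
    · exact isOpen_lt continuous_const (cr_cont p q)

lemma half_closed {C : Set (ℝ × ℝ)} (hC : IsClosed C) (p q : ℝ × ℝ) :
    IsClosed (C ∩ {x | 0 ≤ cr p q x}) :=
  hC.inter (isClosed_le continuous_const (cr_cont p q))

lemma half_frontier {C : Set (ℝ × ℝ)} (hC : Convex ℝ C) (hcl : IsClosed C) {p q : ℝ × ℝ}
    (hpq : p ≠ q) (hp : p ∈ frontier C) (hq : q ∈ frontier C)
    (hint : openSegment ℝ p q ⊆ interior C) :
    frontier (C ∩ {x | 0 ≤ cr p q x}) =
      (frontier C ∩ {x | 0 < cr p q x}) ∪ segment ℝ p q := by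
  rw [(half_closed hcl p q).frontier_eq, half_interior hpq, hcl.frontier_eq]
  ext x
  constructor
  · rintro ⟨⟨h1, h2⟩, h3⟩
    rcases (show 0 ≤ cr p q x from h2).eq_or_lt with h | h
    · exact Or.inr (chord_line hC hcl hpq hp hq hint h1 h.symm)
    · exact Or.inl ⟨⟨h1, fun hi => h3 ⟨hi, h⟩⟩, h⟩
  · rintro (⟨⟨h1, h2⟩, h3⟩ | h)
    · exact ⟨⟨h1, (show 0 < cr p q x from h3).le⟩, fun hi => h2 hi.1⟩
    · have h0 : cr p q x = 0 := by
        obtain ⟨s, t, hs, ht, hst, rfl⟩ := h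
        rw [cr_combo _ _ _ _ _ _ hst, cr_left, cr_right]; ring
      refine ⟨⟨hC.segment_subset (hcl.frontier_subset hp) (hcl.frontier_subset hq) h,
        by simp [h0]⟩, ?_⟩
      rintro ⟨_, h⟩
      simp [h0] at h

variable {ι : Type} [Fintype ι] [DecidableEq ι]

/-- The affine basis given by a triangle. -/
noncomputable def tb (D : TriDisk ι) {t : ι × ι × ι} (ht : t ∈ D.tris) :
    AffineBasis (Fin 3) ℝ (ℝ × ℝ) where
  toFun := ![D.pos t.1, D.pos t.2.1, D.pos t.2.2]
  ind' := D.indep t ht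
  tot' := by
    rw [(D.indep t ht).affineSpan_eq_top_iff_card_eq_finrank_add_one]
    simp

lemma tb_apply (D : TriDisk ι) {t : ι × ι × ι} (ht : t ∈ D.tris) (i : Fin 3) :
    tb D ht i = ![D.pos t.1, D.pos t.2.1, D.pos t.2.2] i := rfl

lemma tb_vert (D : TriDisk ι) {t : ι × ι × ι} (ht : t ∈ D.tris) (i : Fin 3) :
    tb D ht i = D.pos (![t.1, t.2.1, t.2.2] i) := by
  rw [tb_apply]; fin_cases i <;> rfl

lemma mem_vset {t : ι × ι × ι} {c : ι} : c ∈ vset t ↔ ∃ i : Fin 3, ![t.1, t.2.1, t.2.2] i = c := by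
  simp [vset, Fin.exists_fin_succ, eq_comm]

lemma triSet_eq (D : TriDisk ι) {t : ι × ι × ι} (ht : t ∈ D.tris) :
    triSet D.pos t = convexHull ℝ (range (tb D ht)) := by
  have : range (tb D ht) = {D.pos t.1, D.pos t.2.1, D.pos t.2.2} := by
    ext x
    simp [Fin.exists_fin_succ, tb_apply, eq_comm]
  rw [this]; rfl

lemma triSet_eq' (D : TriDisk ι) (t : ι × ι × ι) :
    triSet D.pos t = convexHull ℝ (D.pos '' (vset t : Set ι)) := by
  unfold triSet vset
  congr 1
  ext x
  simp [eq_comm]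

lemma tri_convex (D : TriDisk ι) (t : ι × ι × ι) : Convex ℝ (triSet D.pos t) :=
  convex_convexHull ℝ _

lemma vert_mem (D : TriDisk ι) {t : ι × ι × ι} {v : ι} (hv : v ∈ vset t) :
    D.pos v ∈ triSet D.pos t := by
  rw [triSet_eq']
  exact subset_convexHull ℝ _ ⟨v, hv, rfl⟩

lemma exists_coord (D : TriDisk ι) {t : ι × ι × ι} (ht : t ∈ D.tris) {c : ι} (hc : c ∈ vset t) :
    ∃ φ : (ℝ × ℝ) →ᵃ[ℝ] ℝ, φ (D.pos c) = 1 ∧ ∀ e ∈ vset t, e ≠ c → φ (D.pos e) = 0 := by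
  obtain ⟨i, rfl⟩ := mem_vset.1 hc
  refine ⟨(tb D ht).coord i, ?_, ?_⟩
  · rw [← tb_vert D ht i]; simp
  · intro e he hne
    obtain ⟨j, rfl⟩ := mem_vset.1 he
    rw [← tb_vert D ht j]
    apply AffineBasis.coord_apply_ne
    rintro rfl; exact hne rfl

lemma aff_openSeg (φ : (ℝ × ℝ) →ᵃ[ℝ] ℝ) {p q y : ℝ × ℝ} (hy : y ∈ openSegment ℝ p q) :
    ∃ s t : ℝ, 0 < s ∧ 0 < t ∧ φ y = s * φ p + t * φ q := by
  obtain ⟨s, t, hs, ht, hst, rfl⟩ := hy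
  refine ⟨s, t, hs, ht, ?_⟩
  simpa using Convex.combo_affine_apply (f := φ) hst

lemma aff_zero_hull (φ : (ℝ × ℝ) →ᵃ[ℝ] ℝ) {S : Set (ℝ × ℝ)} (h : ∀ x ∈ S, φ x = 0) :
    ∀ x ∈ convexHull ℝ S, φ x = 0 := by
  have : convexHull ℝ S ⊆ φ ⁻¹' {0} :=
    convexHull_min (fun x hx => h x hx) ((convex_singleton (0 : ℝ)).affine_preimage φ)
  exact fun x hx => this hx

/-- A triangle containing a point of an open edge has both ends of the edge as vertices. -/
lemma edge_mem (D : TriDisk ι) {s t : ι × ι × ι} (hs : s ∈ D.tris) (ht : t ∈ D.tris) {c d : ι}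
    (hc : c ∈ vset t) (hd : d ∈ vset t) (hcd : c ≠ d) {y : ℝ × ℝ}
    (hy : y ∈ openSegment ℝ (D.pos c) (D.pos d)) (hys : y ∈ triSet D.pos s) : c ∈ vset s := by
  by_contra hcs
  have hyt : y ∈ triSet D.pos t := by
    exact (tri_convex D t).openSegment_subset (vert_mem D hc) (vert_mem D hd) hy
  have hg : y ∈ triSet D.pos s ∩ triSet D.pos t := ⟨hys, hyt⟩
  rw [D.glue s hs t ht] at hg
  obtain ⟨φ, h1, h0⟩ := exists_coord D ht hc
  obtain ⟨a, b, ha, hb, e⟩ := aff_openSeg φ hy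
  have hz := aff_zero_hull φ (S := D.pos '' ((vset s ∩ vset t : Finset ι) : Set ι)) (by
    rintro _ ⟨v, hv, rfl⟩
    have hv' := Finset.mem_inter.1 (Finset.mem_coe.1 hv)
    refine h0 v hv'.2 ?_
    rintro rfl; exact hcs hv'.1) y hg
  rw [h1, h0 d hd hcd.symm] at e
  linarith

lemma vertex_not_openSeg (D : TriDisk ι) {s t : ι × ι × ι} (hs : s ∈ D.tris) (ht : t ∈ D.tris)
    {c d v : ι} (hc : c ∈ vset t) (hd : d ∈ vset t) (hcd : c ≠ d) (hv : v ∈ vset s) :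
    D.pos v ∉ openSegment ℝ (D.pos c) (D.pos d) := by
  intro hy
  have hys : D.pos v ∈ triSet D.pos s := by
    rw [triSet_eq']; exact subset_convexHull ℝ _ ⟨v, hv, rfl⟩
  have hcs := edge_mem D hs ht hc hd hcd hy hys
  have hds := edge_mem D hs ht hd hc hcd.symm (by rwa [openSegment_symm]) hys
  by_cases hvc : v = c
  · subst hvc
    exact hcd (D.inj (left_mem_openSegment_iff.1 hy))
  · obtain ⟨φ, h1, h0⟩ := exists_coord D hs hcs
    obtain ⟨a, b, ha, hb, e⟩ := aff_openSeg φ hy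
    rw [h1, h0 d hds hcd.symm, h0 v hv hvc] at e
    linarith

lemma edges_meet (D : TriDisk ι) {s t : ι × ι × ι} (hs : s ∈ D.tris) (ht : t ∈ D.tris)
    {a b c d : ι} (hc : c ∈ vset t) (hd : d ∈ vset t) (hcd : c ≠ d)
    (ha : a ∈ vset s) (hb : b ∈ vset s) (hab : a ≠ b) {y : ℝ × ℝ}
    (hy : y ∈ openSegment ℝ (D.pos c) (D.pos d)) (hy' : y ∈ openSegment ℝ (D.pos a) (D.pos b)) :
    c = a ∨ c = b := by
  have hys : y ∈ triSet D.pos s := by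
    exact (tri_convex D s).openSegment_subset (vert_mem D ha) (vert_mem D hb) hy'
  have hcs := edge_mem D hs ht hc hd hcd hy hys
  have hds := edge_mem D hs ht hd hc hcd.symm (by rwa [openSegment_symm]) hys
  by_contra hn
  push Not at hn
  obtain ⟨φ, h1, h0⟩ := exists_coord D hs hcs
  obtain ⟨u, v, hu, hv, e⟩ := aff_openSeg φ hy
  obtain ⟨u', v', hu', hv', e'⟩ := aff_openSeg φ hy'
  rw [h1, h0 d hds hcd.symm] at e
  rw [h0 a ha hn.1.symm, h0 b hb hn.2.symm] at e'
  linarith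

lemma triSet_compact (D : TriDisk ι) (t : ι × ι × ι) : IsCompact (triSet D.pos t) := by
  unfold triSet
  exact Set.Finite.isCompact_convexHull (𝕜 := ℝ) (Set.toFinite _)

lemma triSet_subset_space (D : TriDisk ι) {t : ι × ι × ι} (ht : t ∈ D.tris) :
    triSet D.pos t ⊆ D.space := by
  unfold TriDisk.space
  exact subset_biUnion_of_mem (u := fun t => triSet D.pos t) ht

lemma space_compact (D : TriDisk ι) : IsCompact D.space := by
  unfold TriDisk.space
  exact D.tris.finite_toSet.isCompact_biUnion (fun t _ => triSet_compact D t)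

lemma frontier_compact (D : TriDisk ι) : IsCompact (frontier D.space) :=
  (space_compact D).of_isClosed_subset isClosed_frontier (space_compact D).isClosed.frontier_subset

lemma triSet_interior_nonempty (D : TriDisk ι) {t : ι × ι × ι} (ht : t ∈ D.tris) :
    (interior (triSet D.pos t)).Nonempty := by
  rw [triSet_eq D ht]
  exact ⟨_, (tb D ht).centroid_mem_interior_convexHull⟩

lemma space_subset_closure_interior (D : TriDisk ι) : D.space ⊆ closure (interior D.space) := by
  intro x hx
  unfold TriDisk.space at hx
  obtain ⟨t, ht, hxt⟩ := mem_iUnion₂.1 hx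
  have hconv : Convex ℝ (triSet D.pos t) := convex_convexHull ℝ _
  have := hconv.closure_interior_eq_closure_of_nonempty_interior (triSet_interior_nonempty D ht)
  exact closure_mono (interior_mono (triSet_subset_space D ht)) (this ▸ subset_closure hxt)

lemma on_edge (D : TriDisk ι) {t : ι × ι × ι} (ht : t ∈ D.tris) {x : ℝ × ℝ}
    (hx : x ∈ triSet D.pos t) (hni : x ∉ interior (triSet D.pos t)) :
    ∃ c ∈ vset t, ∃ d ∈ vset t, c ≠ d ∧ x ∈ segment ℝ (D.pos c) (D.pos d) := by
  rw [triSet_eq D ht] at hx hni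
  rw [(tb D ht).interior_convexHull] at hni
  rw [(tb D ht).convexHull_eq_nonneg_coord] at hx
  simp only [mem_ofPred_eq, not_forall, not_lt] at hni hx
  obtain ⟨i, hi⟩ := hni
  have hi0 : (tb D ht).coord i x = 0 := le_antisymm hi (hx i)
  have hsum := (tb D ht).sum_coord_apply_eq_one x
  have hlin := (tb D ht).linear_combination_coord_eq_self x
  simp only [tb_apply, Fin.sum_univ_three] at hsum hlin
  have hinj : Function.Injective (tb D ht) := (tb D ht).ind.injective
  have mv : ∀ j : Fin 3, ![t.1, t.2.1, t.2.2] j ∈ vset t := fun j => mem_vset.2 ⟨j, rfl⟩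
  have ne : ∀ j k : Fin 3, j ≠ k → ![t.1, t.2.1, t.2.2] j ≠ ![t.1, t.2.1, t.2.2] k := by
    intro j k hjk h
    apply hjk
    apply hinj
    rw [tb_vert, tb_vert, h]
  fin_cases i
  · refine ⟨_, mv 1, _, mv 2, ne 1 2 (by decide), (tb D ht).coord 1 x, (tb D ht).coord 2 x,
      hx 1, hx 2, ?_, ?_⟩
    · simp at hi0; linarith
    · simp at hi0; simpa [hi0] using hlin
  · refine ⟨_, mv 0, _, mv 2, ne 0 2 (by decide), (tb D ht).coord 0 x, (tb D ht).coord 2 x,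
      hx 0, hx 2, ?_, ?_⟩
    · simp at hi0; linarith
    · simp at hi0; simpa [hi0] using hlin
  · refine ⟨_, mv 0, _, mv 1, ne 0 1 (by decide), (tb D ht).coord 0 x, (tb D ht).coord 1 x,
      hx 0, hx 1, ?_, ?_⟩
    · simp at hi0; linarith
    · simp at hi0; simpa [hi0] using hlin

lemma seg_subset_tri (D : TriDisk ι) {t : ι × ι × ι} {c d : ι} (hc : c ∈ vset t)
    (hd : d ∈ vset t) : segment ℝ (D.pos c) (D.pos d) ⊆ triSet D.pos t := by
  exact (tri_convex D t).segment_subset (vert_mem D hc) (vert_mem D hd)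

/-- Homothety argument: sliding an interior point along an edge. -/
lemma slide {U : Set (ℝ × ℝ)} {p y z : ℝ × ℝ} (hU : ∀ x ∈ U, ∀ r : ℝ, 0 < r → r < 1 →
    (1 - r) • p + r • x ∈ U) (hy : y ∈ interior U) (hz : z ∈ openSegment ℝ p y) :
    z ∈ interior U := by
  obtain ⟨s, r, hs, hr, hsr, rfl⟩ := hz
  have hs' : s = 1 - r := by linarith
  subst hs'
  set h : (ℝ × ℝ) ≃ₜ (ℝ × ℝ) :=
    (Homeomorph.smulOfNeZero r hr.ne').trans (Homeomorph.addLeft ((1 - r) • p)) with hh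
  have hv : ∀ x, h x = (1 - r) • p + r • x := fun x => rfl
  have : h '' interior U ⊆ interior U := by
    apply interior_maximal
    · rintro _ ⟨x, hx, rfl⟩
      rw [hv]
      exact hU x (interior_subset hx) r hr (by linarith)
    · exact h.isOpenMap _ isOpen_interior
  rw [← hv]
  exact this ⟨y, hy, rfl⟩

lemma edge_interior (D : TriDisk ι) {t : ι × ι × ι} (ht : t ∈ D.tris) {c d : ι}
    (hc : c ∈ vset t) (hd : d ∈ vset t) (hcd : c ≠ d) {y : ℝ × ℝ}
    (hy : y ∈ openSegment ℝ (D.pos c) (D.pos d)) (hyi : y ∈ interior D.space) :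
    openSegment ℝ (D.pos c) (D.pos d) ⊆ interior D.space := by
  set U : Set (ℝ × ℝ) := ⋃ s ∈ D.tris.filter (fun s => c ∈ vset s ∧ d ∈ vset s), triSet D.pos s
    with hU
  set W : Set (ℝ × ℝ) := ⋃ s ∈ D.tris.filter (fun s => ¬ (c ∈ vset s ∧ d ∈ vset s)), triSet D.pos s
    with hW
  have hWc : IsClosed W := by
    rw [hW]
    exact ((Finset.finite_toSet _).isCompact_biUnion (fun t _ => triSet_compact D t)).isClosed
  have hUs : U ⊆ D.space := by
    intro x hx
    obtain ⟨s, hs, hxs⟩ := mem_iUnion₂.1 hx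
    exact triSet_subset_space D (Finset.mem_filter.1 hs).1 hxs
  have hDU : D.space ⊆ U ∪ W := by
    intro x hx
    unfold TriDisk.space at hx
    obtain ⟨s, hs, hxs⟩ := mem_iUnion₂.1 hx
    by_cases h : c ∈ vset s ∧ d ∈ vset s
    · exact Or.inl (mem_iUnion₂.2 ⟨s, Finset.mem_filter.2 ⟨hs, h⟩, hxs⟩)
    · exact Or.inr (mem_iUnion₂.2 ⟨s, Finset.mem_filter.2 ⟨hs, h⟩, hxs⟩)
  have hyW : y ∉ W := by
    intro h
    obtain ⟨s, hs, hxs⟩ := mem_iUnion₂.1 h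
    obtain ⟨hs1, hs2⟩ := Finset.mem_filter.1 hs
    exact hs2 ⟨edge_mem D hs1 ht hc hd hcd hy hxs,
      edge_mem D hs1 ht hd hc hcd.symm (by rwa [openSegment_symm]) hxs⟩
  have hyU : y ∈ interior U := by
    refine mem_interior.2 ⟨interior D.space ∩ Wᶜ, ?_, isOpen_interior.inter hWc.isOpen_compl,
      hyi, hyW⟩
    rintro x ⟨h1, h2⟩
    exact (hDU (interior_subset h1)).resolve_right h2
  have hom : ∀ v, (v = c ∨ v = d) → ∀ x ∈ U, ∀ r : ℝ, 0 < r → r < 1 →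
      (1 - r) • D.pos v + r • x ∈ U := by
    intro v hv x hx r hr hr1
    obtain ⟨s, hs, hxs⟩ := mem_iUnion₂.1 hx
    refine mem_iUnion₂.2 ⟨s, hs, ?_⟩
    have hvs : v ∈ vset s := by
      rcases hv with rfl | rfl
      · exact (Finset.mem_filter.1 hs).2.1
      · exact (Finset.mem_filter.1 hs).2.2
    exact (tri_convex D s) (vert_mem D hvs) hxs (by linarith) hr.le (by ring)
  intro z hz
  apply interior_mono hUs
  have hins : z ∈ insert y (openSegment ℝ (D.pos c) y ∪ openSegment ℝ y (D.pos d)) := by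
    apply openSegment_subset_union _ _ _ hz
    obtain ⟨s, t, hs, ht, hst, rfl⟩ := hy
    refine ⟨t, ?_⟩
    simp only [AffineMap.lineMap_apply_module]
    rw [← hst]; simp
  rcases hins with rfl | h | h
  · exact hyU
  · exact slide (hom c (Or.inl rfl)) hyU h
  · exact slide (hom d (Or.inr rfl)) hyU (by rwa [openSegment_symm])

lemma seg_of_openSeg {S : Set (ℝ × ℝ)} (hS : IsClosed S) {p q : ℝ × ℝ}
    (h : openSegment ℝ p q ⊆ S) : segment ℝ p q ⊆ S := by
  rw [← closure_openSegment]
  exact closure_minimal h hS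

lemma isClosed_seg (p q : ℝ × ℝ) : IsClosed (segment ℝ p q) := by
  rw [segment_eq_image]
  exact (isCompact_Icc.image (by fun_prop)).isClosed

lemma frontier_nonvertex (D : TriDisk ι) {x : ℝ × ℝ} (hx : x ∈ frontier D.space)
    (hv : ∀ v, x ≠ D.pos v) : ∃ c d, D.IsBoundaryEdge c d ∧ x ∈ segment ℝ (D.pos c) (D.pos d) := by
  have hcl := (space_compact D).isClosed
  have hxs := hcl.frontier_subset hx
  have hxs' := hxs
  unfold TriDisk.space at hxs'
  obtain ⟨t, ht, hxt⟩ := mem_iUnion₂.1 hxs'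
  obtain ⟨c, hc, d, hd, hcd, hxe⟩ := on_edge D ht hxt
    (fun h => hx.2 (interior_mono (triSet_subset_space D ht) h))
  refine ⟨c, d, ⟨⟨hcd, t, ht, hc, hd⟩, ?_⟩, hxe⟩
  rcases mem_seg_cases hxe with h | h | h
  · exact absurd h (hv c)
  · exact absurd h (hv d)
  · apply seg_of_openSeg isClosed_frontier
    intro z hz
    refine ⟨subset_closure (triSet_subset_space D ht (seg_subset_tri D hc hd
      (openSegment_subset_segment ℝ _ _ hz))), fun hzi => ?_⟩
    exact hx.2 (edge_interior D ht hc hd hcd hz hzi h)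

lemma punctured_ball (x : ℝ × ℝ) {r : ℝ} (hr : 0 < r) :
    IsPreconnected (Metric.ball x r \ {x}) := by
  have h0 : IsPreconnected ({(0 : ℝ × ℝ)}ᶜ : Set (ℝ × ℝ)) :=
    (isConnected_compl_singleton_of_one_lt_rank (by
      rw [← Module.finrank_eq_rank]; simp) 0).isPreconnected
  have hpos : ∀ u : ℝ × ℝ, 0 < 1 + ‖u‖ := fun u => by positivity
  have hc : Continuous (fun u : ℝ × ℝ => x + (r / (1 + ‖u‖)) • u) := by
    refine continuous_const.add (Continuous.smul (continuous_const.div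
      (continuous_const.add continuous_norm) ?_) continuous_id)
    intro u; exact (hpos u).ne'
  have := h0.image _ hc.continuousOn
  convert this using 1
  ext y
  constructor
  · rintro ⟨hy, hne⟩
    rw [mem_ball_iff_norm] at hy
    have hd : 0 < r - ‖y - x‖ := by linarith
    have hne' : y - x ≠ 0 := sub_ne_zero.2 hne
    refine ⟨(1 / (r - ‖y - x‖)) • (y - x), ?_, ?_⟩
    · simp only [mem_compl_iff, mem_singleton_iff, smul_eq_zero, not_or]
      exact ⟨by positivity, hne'⟩
    · simp only [norm_smul, smul_smul]
      have : r / (1 + ‖1 / (r - ‖y - x‖)‖ * ‖y - x‖) * (1 / (r - ‖y - x‖)) = 1 := by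
        rw [Real.norm_of_nonneg (by positivity)]
        have : 1 + 1 / (r - ‖y - x‖) * ‖y - x‖ = r / (r - ‖y - x‖) := by
          field_simp; ring
        rw [this]; field_simp
      rw [this]; simp
  · rintro ⟨u, hu, rfl⟩
    have hu' : u ≠ 0 := hu
    have := hpos u
    refine ⟨?_, ?_⟩
    · rw [mem_ball_iff_norm]
      simp only [add_sub_cancel_left, norm_smul]
      rw [Real.norm_of_nonneg (by positivity), div_mul_eq_mul_div, div_lt_iff₀ this]
      nlinarith
    · simp only [mem_singleton_iff, add_eq_left, smul_eq_zero, not_or]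
      exact ⟨by positivity, hu'⟩

lemma frontier_edges (D : TriDisk ι) {x : ℝ × ℝ} (hx : x ∈ frontier D.space) :
    ∃ c d, D.IsBoundaryEdge c d ∧ x ∈ segment ℝ (D.pos c) (D.pos d) := by
  by_contra hno
  have hcl := (space_compact D).isClosed
  set B : Set (ℝ × ℝ) := ⋃ e ∈ {e : ι × ι | D.IsBoundaryEdge e.1 e.2},
    segment ℝ (D.pos e.1) (D.pos e.2) with hB
  have hBc : IsClosed B := (Set.toFinite _).isClosed_biUnion (fun e _ => isClosed_seg _ _)
  have hxB : x ∉ B := by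
    intro h
    obtain ⟨e, he, hxe⟩ := mem_iUnion₂.1 h
    exact hno ⟨e.1, e.2, he, hxe⟩
  set P : Set (ℝ × ℝ) := range D.pos \ {x} with hP
  have hPc : IsClosed P := ((Set.finite_range D.pos).subset sdiff_subset).isClosed
  have hN : Bᶜ ∩ Pᶜ ∈ 𝓝 x :=
    (hBc.isOpen_compl.inter hPc.isOpen_compl).mem_nhds ⟨hxB, fun h => h.2 rfl⟩
  obtain ⟨r, hr, hball⟩ := Metric.mem_nhds_iff.1 hN
  have hpre := punctured_ball x hr
  have hcov : Metric.ball x r \ {x} ⊆ interior D.space ∪ D.spaceᶜ := by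
    rintro y ⟨hy, hyx⟩
    by_contra hn
    simp only [mem_union, mem_compl_iff, not_or, not_not] at hn
    have hyf : y ∈ frontier D.space := ⟨subset_closure hn.2, hn.1⟩
    have hyv : ∀ v, y ≠ D.pos v := by
      rintro v rfl
      exact (hball hy).2 ⟨⟨v, rfl⟩, hyx⟩
    obtain ⟨c, d, h1, h2⟩ := frontier_nonvertex D hyf hyv
    exact (hball hy).1 (mem_iUnion₂.2 ⟨(c, d), h1, h2⟩)
  have hmeet : ((Metric.ball x r \ {x}) ∩ interior D.space).Nonempty := by
    have := mem_closure_iff.1 (space_subset_closure_interior D (hcl.frontier_subset hx))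
      (Metric.ball x r) Metric.isOpen_ball (Metric.mem_ball_self hr)
    obtain ⟨y, hy1, hy2⟩ := this
    refine ⟨y, ⟨hy1, ?_⟩, hy2⟩
    rintro rfl
    exact hx.2 hy2
  have hsub := hpre.subset_left_of_subset_union isOpen_interior hcl.isOpen_compl
    (by
      rw [Set.disjoint_left]
      intro y hy hy'
      exact hy' (interior_subset hy)) hcov hmeet
  apply hx.2
  refine mem_interior.2 ⟨Metric.ball x r, ?_, Metric.isOpen_ball, Metric.mem_ball_self hr⟩
  intro y hy
  by_cases h : y = x
  · rw [h]; exact hcl.frontier_subset hx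
  · exact interior_subset (hsub ⟨hy, h⟩)

lemma SL_cont (D : TriDisk ι) {F : ℝ × ℝ → ℝ × ℝ} (h : D.SLOnBoundary F) :
    ContinuousOn F (frontier D.space) := by
  have hB : ContinuousOn F (⋃ e : {e : ι × ι // D.IsBoundaryEdge e.1 e.2},
      segment ℝ (D.pos e.1.1) (D.pos e.1.2)) := by
    apply LocallyFinite.continuousOn_iUnion (locallyFinite_of_finite _)
    · intro e; exact isClosed_seg _ _
    · intro e
      obtain ⟨g, hg⟩ := h e.1.1 e.1.2 e.2
      exact (g.continuous_of_finiteDimensional.continuousOn).congr hg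
  refine hB.mono ?_
  intro x hx
  obtain ⟨c, d, h1, h2⟩ := frontier_edges D hx
  exact mem_iUnion.2 ⟨⟨(c, d), h1⟩, h2⟩

lemma exit_half {X : Set (ℝ × ℝ)} (hX : IsCompact X) {p q y : ℝ × ℝ} (hpq : p ≠ q)
    (hy : y ∈ interior X) (hpos : 0 < cr p q y) : ∃ x ∈ frontier X, 0 < cr p q x := by
  by_contra hno
  push Not at hno
  set H : Set (ℝ × ℝ) := {x | 0 < cr p q x} with hH
  have hHc : Convex ℝ H := by
    intro x hx y hy s t hs ht hst
    simp only [hH, mem_ofPred_eq] at hx hy ⊢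
    rw [cr_combo _ _ _ _ _ _ hst]
    rcases hs.eq_or_lt with rfl | hs
    · have : t = 1 := by linarith
      subst this; simpa using hy
    · have := mul_pos hs hx
      have := mul_nonneg ht hy.le
      linarith
  have hsub : H ⊆ interior X := by
    refine hHc.isPreconnected.subset_left_of_subset_union isOpen_interior hX.isClosed.isOpen_compl
      ?_ ?_ ⟨y, hpos, hy⟩
    · rw [Set.disjoint_left]
      intro w hw hw'
      exact hw' (interior_subset hw)
    · intro w hw
      by_contra hn
      simp only [mem_union, mem_compl_iff, not_or, not_not] at hn
      have h1 := hno w ⟨subset_closure hn.2, hn.1⟩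
      have h2 : 0 < cr p q w := hw
      linarith
  obtain ⟨n, c, hc, hn⟩ := cr_dir hpq
  obtain ⟨M, hM⟩ := hX.bddAbove_image (cr_cont p q).continuousOn
  have hyM : cr p q y ≤ M := hM ⟨y, interior_subset hy, rfl⟩
  have hs : 0 ≤ (M - cr p q y + 1) / c := by
    apply div_nonneg _ hc.le; linarith
  have e := hn y ((M - cr p q y + 1) / c)
  rw [div_mul_cancel₀ _ hc.ne'] at e
  have hmem : y + ((M - cr p q y + 1) / c) • n ∈ H := by
    simp only [hH, mem_ofPred_eq, e]; linarith
  have := hM ⟨_, interior_subset (hsub hmem), rfl⟩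
  rw [e] at this
  linarith

lemma cr_seg {p q x : ℝ × ℝ} (h : x ∈ segment ℝ p q) : cr p q x = 0 := by
  obtain ⟨s, t, hs, ht, hst, rfl⟩ := h
  rw [cr_combo _ _ _ _ _ _ hst, cr_left, cr_right]; ring

lemma piece_frontier_nonempty (E : TriDisk ι) {p q : ℝ × ℝ} (hpq : p ≠ q) :
    ∃ x ∈ frontier E.space, x ∉ segment ℝ p q := by
  obtain ⟨t, ht⟩ := E.nonempty
  obtain ⟨y, hy⟩ := triSet_interior_nonempty E ht
  have hy' := interior_mono (triSet_subset_space E ht) hy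
  have main : ∀ p q : ℝ × ℝ, p ≠ q → ∀ y ∈ interior E.space, 0 < cr p q y →
      ∃ x ∈ frontier E.space, x ∉ segment ℝ p q := by
    intro p q hpq y hy hpos
    obtain ⟨x, hx, hx0⟩ := exit_half (space_compact E) hpq hy hpos
    refine ⟨x, hx, fun h => ?_⟩
    rw [cr_seg h] at hx0
    exact lt_irrefl _ hx0
  rcases lt_trichotomy (cr p q y) 0 with h | h | h
  · obtain ⟨x, hx, hx0⟩ := main q p hpq.symm y hy' (by rw [cr_swap]; linarith)
    exact ⟨x, hx, by rwa [segment_symm]⟩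
  · obtain ⟨z, hz, hz0⟩ := (exists_near hpq isOpen_interior hy').1
    exact main p q hpq z hz (by linarith)
  · exact main p q hpq y hy' h

lemma frontier_piece {X X1 X2 S : Set (ℝ × ℝ)} (h1 : IsClosed X1) (h2 : IsClosed X2)
    (hu : X1 ∪ X2 = X) (hi : X1 ∩ X2 = S) {x : ℝ × ℝ} (hx : x ∈ frontier X1) :
    x ∈ frontier X ∨ x ∈ S := by
  have hx1 := h1.frontier_subset hx
  by_cases hx2 : x ∈ X2
  · exact Or.inr (hi ▸ ⟨hx1, hx2⟩)
  · left
    refine ⟨subset_closure (hu ▸ Or.inl hx1), fun hxi => hx.2 ?_⟩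
    refine mem_interior.2 ⟨interior X ∩ X2ᶜ, ?_, isOpen_interior.inter h2.isOpen_compl, hxi, hx2⟩
    rintro y ⟨hy, hy2⟩
    have : y ∈ X1 ∪ X2 := hu ▸ interior_subset hy
    exact this.resolve_right hy2

lemma seg_frontier_piece {X1 X2 : Set (ℝ × ℝ)} {p q : ℝ × ℝ} (hpq : p ≠ q)
    (hi : X1 ∩ X2 = segment ℝ p q) (hd : X2 ⊆ closure (interior X2)) :
    segment ℝ p q ⊆ frontier X1 := by
  intro x hx
  have hx' : x ∈ X1 ∩ X2 := hi ▸ hx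
  refine ⟨subset_closure hx'.1, fun hxi => ?_⟩
  obtain ⟨y, hy1, hy2⟩ := mem_closure_iff.1 (hd hx'.2) _ isOpen_interior hxi
  obtain ⟨z, hz, hlt⟩ := (exists_near hpq (isOpen_interior.inter isOpen_interior)
    (show y ∈ interior X1 ∩ interior X2 from ⟨hy1, hy2⟩)).1
  have hy0 : cr p q y = 0 := cr_seg (hi ▸ ⟨interior_subset hy1, interior_subset hy2⟩)
  have hz0 : cr p q z = 0 := cr_seg (hi ▸ ⟨interior_subset hz.1, interior_subset hz.2⟩)
  linarith

lemma openSeg_int_of_not_obs (D : TriDisk ι) {F : ℝ × ℝ → ℝ × ℝ} (hSL : D.SLOnBoundary F)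
    (hinj : InjOn F (frontier D.space)) {C : Set (ℝ × ℝ)} (hC : Convex ℝ C) (hco : IsCompact C)
    (hne : (interior C).Nonempty) (him : F '' frontier D.space = frontier C) {c d : ι}
    (hs : D.IsSpanningEdge c d) (hno : ¬ D.Obstructive F c d) :
    openSegment ℝ (F (D.pos c)) (F (D.pos d)) ⊆ interior C := by
  intro z hz
  by_contra hzi
  have hzC : z ∈ C := hC.openSegment_subset
    (hco.isClosed.frontier_subset (him ▸ mem_image_of_mem F hs.2.1))
    (hco.isClosed.frontier_subset (him ▸ mem_image_of_mem F hs.2.2.1)) hz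
  exact hno ⟨hs, obstr_of_meet (frontier_compact D) (SL_cont D hSL) hinj hC hco.isClosed hne him
    hs.2.1 hs.2.2.1 (fun h => hs.1.1 (D.inj h)) hz ⟨subset_closure hzC, hzi⟩⟩

lemma piece_main (D D₁ D₂ : TriDisk ι) (a b : ι)
    (hσ : D.IsSpanningEdge a b)
    (hpos₁ : D₁.pos = D.pos)
    (htris : D₁.tris ⊆ D.tris)
    (hsp : D₁.space ∪ D₂.space = D.space)
    (hcap : D₁.space ∩ D₂.space = segment ℝ (D.pos a) (D.pos b))
    (F : ℝ × ℝ → ℝ × ℝ)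
    (hSL : D.SLOnBoundary F)
    (hinj : Set.InjOn F (frontier D.space))
    (hconv : D.ConvexImage F)
    (hnotobs : ¬ D.Obstructive F a b) :
      ∃ Fi : ℝ × ℝ → ℝ × ℝ,
        Set.EqOn Fi F (frontier D₁.space ∩ frontier D.space) ∧
        (∃ g : (ℝ × ℝ) →ᵃ[ℝ] (ℝ × ℝ),
          Set.EqOn Fi g (segment ℝ (D.pos a) (D.pos b)) ∧
          g (D.pos a) = F (D.pos a) ∧ g (D.pos b) = F (D.pos b)) ∧
        D₁.SLOnBoundary Fi ∧
        Set.InjOn Fi (frontier D₁.space) ∧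
        D₁.ConvexImage Fi ∧
        ((∀ c d : ι, ¬ D.Obstructive F c d) →
          ∀ c d : ι, ¬ D₁.Obstructive Fi c d) := by
  classical
  obtain ⟨C, hC, hco, hne, him⟩ := hconv
  have hcl := hco.isClosed
  have hint := openSeg_int_of_not_obs D hSL hinj hC hco hne him hσ hnotobs
  obtain ⟨⟨hab, t₀, ht₀, ha₀, hb₀⟩, hpa, hpb, hopen⟩ := hσ
  have hσ : D.IsSpanningEdge a b := ⟨⟨hab, t₀, ht₀, ha₀, hb₀⟩, hpa, hpb, hopen⟩
  have hF := SL_cont D hSL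
  obtain ⟨φ, hφb, hφ0⟩ := exists_coord D ht₀ hb₀
  have hφa := hφ0 a ha₀ hab
  set p := D.pos a with hp
  set q := D.pos b with hq
  have hpq : p ≠ q := fun h => hab (D.inj h)
  have hFpq : F p ≠ F q := fun h => hpq (hinj hpa hpb h)
  have hfp : F p ∈ frontier C := him ▸ mem_image_of_mem F hpa
  have hfq : F q ∈ frontier C := him ▸ mem_image_of_mem F hpb
  set g : (ℝ × ℝ) →ᵃ[ℝ] (ℝ × ℝ) := (AffineMap.lineMap (F p) (F q)).comp φ with hg
  have hgp : g p = F p := by simp [hg, hφa]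
  have hgq : g q = F q := by simp [hg, hφb]
  have hginj : InjOn g (segment ℝ p q) := by
    have e : ∀ x ∈ segment ℝ p q, x = (1 - φ x) • p + φ x • q := by
      rintro x ⟨s, t, hs, ht, hst, rfl⟩
      have h1 : φ (s • p + t • q) = t := by
        rw [Convex.combo_affine_apply hst, hφa, hφb]; simp
      rw [h1]
      congr 2
      linarith
    intro x hx y hy hxy
    have h2 : φ x = φ y := AffineMap.lineMap_injective ℝ hFpq hxy
    rw [e x hx, e y hy, h2]
  have hgopen : ∀ x ∈ openSegment ℝ p q, g x ∈ openSegment ℝ (F p) (F q) := by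
    intro x hx
    rw [← hgp, ← hgq, ← image_openSegment]
    exact mem_image_of_mem g hx
  have hgseg : g '' segment ℝ p q = segment ℝ (F p) (F q) := by
    rw [image_segment, hgp, hgq]
  have hX1c := (space_compact D₁).isClosed
  have hX2c := (space_compact D₂).isClosed
  have f1 : ∀ x ∈ frontier D₁.space, x ∈ frontier D.space ∨ x ∈ segment ℝ p q :=
    fun x hx => frontier_piece hX1c hX2c hsp hcap hx
  have f1' : ∀ x ∈ frontier D₂.space, x ∈ frontier D.space ∨ x ∈ segment ℝ p q :=
    fun x hx => frontier_piece hX2c hX1c (by rw [union_comm]; exact hsp)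
      (by rw [inter_comm]; exact hcap) hx
  have f2 : segment ℝ p q ⊆ frontier D₁.space :=
    seg_frontier_piece hpq hcap (space_subset_closure_interior D₂)
  have f3 : ∀ x ∈ frontier D.space, x ∈ frontier D₁.space ∪ frontier D₂.space := by
    intro x hx
    have hxX : x ∈ D₁.space ∪ D₂.space := hsp ▸ (space_compact D).isClosed.frontier_subset hx
    rcases hxX with h | h
    · exact Or.inl ⟨subset_closure h, fun hi =>
        hx.2 (interior_mono (by rw [← hsp]; exact subset_union_left) hi)⟩
    · exact Or.inr ⟨subset_closure h, fun hi =>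
        hx.2 (interior_mono (by rw [← hsp]; exact subset_union_right) hi)⟩
  have f4 : ∀ x ∈ segment ℝ p q, x ∈ frontier D.space → x = p ∨ x = q := by
    intro x hx hxf
    rcases mem_seg_cases hx with h | h | h
    · exact Or.inl h
    · exact Or.inr h
    · exact absurd (hopen h) hxf.2
  have f12 : ∀ x ∈ frontier D₁.space, x ∈ frontier D₂.space → x ∈ segment ℝ p q := by
    intro x h1 h2
    rw [← hcap]
    exact ⟨hX1c.frontier_subset h1, hX2c.frontier_subset h2⟩
  have hps : p ∈ segment ℝ p q := left_mem_segment ℝ p q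
  have hqs : q ∈ segment ℝ p q := right_mem_segment ℝ p q
  set Fi : ℝ × ℝ → ℝ × ℝ := fun x => if x ∈ segment ℝ p q then g x else F x with hFi
  have hFiσ : ∀ x ∈ segment ℝ p q, Fi x = g x := fun x hx => by simp [hFi, hx]
  have hFin : ∀ x, x ∉ segment ℝ p q → Fi x = F x := fun x hx => by simp [hFi, hx]
  have hFif : ∀ x ∈ frontier D.space, Fi x = F x := by
    intro x hx
    by_cases h : x ∈ segment ℝ p q
    · rw [hFiσ x h]
      rcases f4 x h hx with rfl | rfl
      · exact hgp
      · exact hgq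
    · exact hFin x h
  -- simplexwise linear
  have hSLi : D₁.SLOnBoundary Fi := by
    rintro c d ⟨⟨hcd, t, ht, hc, hd⟩, hseg⟩
    rw [hpos₁] at hseg ⊢
    by_cases hmeet : ∃ y ∈ openSegment ℝ (D.pos c) (D.pos d), y ∈ openSegment ℝ p q
    · obtain ⟨y, hy1, hy2⟩ := hmeet
      have hcc := edges_meet D ht₀ (htris ht) hc hd hcd ha₀ hb₀ hab hy1 hy2
      have hdd := edges_meet D ht₀ (htris ht) hd hc hcd.symm ha₀ hb₀ hab
        (by rwa [openSegment_symm]) hy2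
      have hs : segment ℝ (D.pos c) (D.pos d) = segment ℝ p q := by
        rcases hcc with rfl | rfl <;> rcases hdd with rfl | rfl
        · exact absurd rfl hcd
        · rfl
        · rw [segment_symm]
        · exact absurd rfl hcd
      exact ⟨g, fun x hx => hFiσ x (hs ▸ hx)⟩
    · have hsub : segment ℝ (D.pos c) (D.pos d) ⊆ frontier D.space := by
        apply seg_of_openSeg isClosed_frontier
        intro y hy
        rcases f1 y (hseg (openSegment_subset_segment ℝ _ _ hy)) with h | h
        · exact h
        · rcases mem_seg_cases h with h | h | h
          · exact h ▸ hpa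
          · exact h ▸ hpb
          · exact absurd ⟨y, hy, h⟩ hmeet
      obtain ⟨g', hg'⟩ := hSL c d ⟨⟨hcd, t, htris ht, hc, hd⟩, hsub⟩
      exact ⟨g', fun x hx => by rw [hFif x (hsub hx), hg' hx]⟩
  -- injectivity
  have hmix : ∀ x ∈ segment ℝ p q, ∀ y ∈ frontier D₁.space, y ∉ segment ℝ p q →
      g x ≠ F y := by
    intro x hx y hy hyn hxy
    have hyf := (f1 y hy).resolve_right hyn
    rcases mem_seg_cases hx with rfl | rfl | h
    · rw [hgp] at hxy
      exact hyn (hinj hpa hyf hxy ▸ hps)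
    · rw [hgq] at hxy
      exact hyn (hinj hpb hyf hxy ▸ hqs)
    · have h1 := hint (hgopen x h)
      have h2 : F y ∈ frontier C := him ▸ mem_image_of_mem F hyf
      exact h2.2 (hxy ▸ h1)
  have hinji : InjOn Fi (frontier D₁.space) := by
    intro x hx y hy hxy
    by_cases h1 : x ∈ segment ℝ p q <;> by_cases h2 : y ∈ segment ℝ p q
    · rw [hFiσ x h1, hFiσ y h2] at hxy
      exact hginj h1 h2 hxy
    · rw [hFiσ x h1, hFin y h2] at hxy
      exact absurd hxy (hmix x h1 y hy h2)
    · rw [hFin x h1, hFiσ y h2] at hxy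
      exact absurd hxy.symm (hmix y h2 x hx h1)
    · rw [hFin x h1, hFin y h2] at hxy
      exact hinj ((f1 x hx).resolve_right h1) ((f1 y hy).resolve_right h2) hxy
  -- sides
  have hcrne : ∀ x ∈ frontier D.space, x ∉ segment ℝ p q → cr (F p) (F q) (F x) ≠ 0 := by
    intro x hx hxn h0
    rcases chord_frontier hC hcl hFpq hfp hfq hint (him ▸ mem_image_of_mem F hx) h0 with h | h
    · exact hxn (hinj hx hpa h ▸ hps)
    · exact hxn (hinj hx hpb h ▸ hqs)
  have side : ∀ P Q, (P = F p ∧ Q = F q ∨ P = F q ∧ Q = F p) →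
      ∀ A B : Set (ℝ × ℝ), IsClosed A → IsClosed B → (∀ x ∈ frontier D.space, x ∈ A ∪ B) →
      (∀ x ∈ A, x ∈ B → x ∈ segment ℝ p q) →
      ∀ x ∈ frontier D.space, x ∈ A → 0 < cr P Q (F x) →
      ∀ y ∈ frontier D.space, 0 < cr P Q (F y) → y ∈ A := by
    intro P Q hPQ A B hA hB hcov hdis x hx hxA hx0 y hy hy0
    by_contra hyA
    have hyB := (hcov y hy).resolve_left hyA
    have harc : IsPreconnected (frontier C ∩ {x | 0 < cr P Q x}) := by
      rcases hPQ with ⟨rfl, rfl⟩ | ⟨rfl, rfl⟩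
      · exact (arc_aux hC hco hFpq hfp hfq hint).1
      · exact (arc_aux hC hco hFpq.symm hfq hfp (by rwa [openSegment_symm])).1
    have hpre := preconn_preimage (frontier_compact D) hF hinj harc
      (by rw [him]; exact inter_subset_left)
    obtain ⟨w, ⟨hwf, hw1, hw2⟩, hwA, hwB⟩ := isPreconnected_closed_iff.1 hpre A B hA hB
      (fun z hz => hcov z hz.1)
      ⟨x, ⟨hx, him ▸ mem_image_of_mem F hx, hx0⟩, hxA⟩
      ⟨y, ⟨hy, him ▸ mem_image_of_mem F hy, hy0⟩, hyB⟩
    have hw2' : 0 < cr P Q (F w) := hw2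
    have hw0 : cr (F p) (F q) (F w) = 0 := by
      rcases f4 w (hdis w hwA hwB) hwf with rfl | rfl
      · exact cr_left _ _
      · exact cr_right _ _
    rcases hPQ with ⟨rfl, rfl⟩ | ⟨rfl, rfl⟩
    · linarith
    · rw [cr_swap] at hw2'; linarith
  obtain ⟨x1, hx1, hx1n⟩ := piece_frontier_nonempty D₁ hpq
  obtain ⟨x2, hx2, hx2n⟩ := piece_frontier_nonempty D₂ hpq
  have hx1f := (f1 x1 hx1).resolve_right hx1n
  have hx2f := (f1' x2 hx2).resolve_right hx2n
  obtain ⟨P, Q, hPQ, hPQ1⟩ : ∃ P Q, (P = F p ∧ Q = F q ∨ P = F q ∧ Q = F p) ∧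
      0 < cr P Q (F x1) := by
    rcases lt_or_gt_of_ne (hcrne x1 hx1f hx1n) with h | h
    · exact ⟨F q, F p, Or.inr ⟨rfl, rfl⟩, by rw [cr_swap]; linarith⟩
    · exact ⟨F p, F q, Or.inl ⟨rfl, rfl⟩, h⟩
  have hPQ' : Q = F p ∧ P = F q ∨ Q = F q ∧ P = F p := by tauto
  have hne' : P ≠ Q := by
    rcases hPQ with ⟨rfl, rfl⟩ | ⟨rfl, rfl⟩
    · exact hFpq
    · exact hFpq.symm
  have hPf : P ∈ frontier C := by rcases hPQ with ⟨rfl, _⟩ | ⟨rfl, _⟩ <;> assumption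
  have hQf : Q ∈ frontier C := by rcases hPQ with ⟨_, rfl⟩ | ⟨_, rfl⟩ <;> assumption
  have hsegPQ : segment ℝ P Q = segment ℝ (F p) (F q) := by
    rcases hPQ with ⟨rfl, rfl⟩ | ⟨rfl, rfl⟩
    · rfl
    · rw [segment_symm]
  have hintPQ : openSegment ℝ P Q ⊆ interior C := by
    rcases hPQ with ⟨rfl, rfl⟩ | ⟨rfl, rfl⟩
    · exact hint
    · rwa [openSegment_symm]
  have hcrne' : ∀ x ∈ frontier D.space, x ∉ segment ℝ p q → cr P Q (F x) ≠ 0 := by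
    intro x hx hxn
    have := hcrne x hx hxn
    rcases hPQ with ⟨rfl, rfl⟩ | ⟨rfl, rfl⟩
    · exact this
    · rw [cr_swap]; simpa using this
  have s1 := side P Q hPQ _ _ isClosed_frontier isClosed_frontier f3 f12 x1 hx1f hx1 hPQ1
  have hx2neg : 0 < cr Q P (F x2) := by
    rw [cr_swap]
    rcases lt_or_gt_of_ne (hcrne' x2 hx2f hx2n) with h | h
    · linarith
    · exact absurd (f12 x2 (s1 x2 hx2f h) hx2) hx2n
  have s2 := side Q P hPQ' _ _ isClosed_frontier isClosed_frontier
    (fun x hx => (f3 x hx).symm) (fun x h1 h2 => f12 x h2 h1) x2 hx2f hx2 hx2neg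
  have hfr := half_frontier hC hcl hne' hPf hQf hintPQ
  have himi : Fi '' frontier D₁.space = frontier (C ∩ {x | 0 ≤ cr P Q x}) := by
    rw [hfr, hsegPQ, ← hgseg]
    ext z
    constructor
    · rintro ⟨x, hx, rfl⟩
      by_cases h : x ∈ segment ℝ p q
      · exact Or.inr ⟨x, h, (hFiσ x h).symm⟩
      · left
        have hxf := (f1 x hx).resolve_right h
        rw [hFin x h]
        refine ⟨him ▸ mem_image_of_mem F hxf, ?_⟩
        rcases lt_or_gt_of_ne (hcrne' x hxf h) with h' | h'
        · exact absurd (f12 x hx (s2 x hxf (by rw [cr_swap]; linarith))) h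
        · exact h'
    · rintro (⟨h1, h2⟩ | ⟨x, hx, rfl⟩)
      · obtain ⟨x, hxf, rfl⟩ : z ∈ F '' frontier D.space := him ▸ h1
        exact ⟨x, s1 x hxf h2, hFif x hxf⟩
      · exact ⟨x, f2 hx, hFiσ x hx⟩
  have hC' := half_convex hC P Q
  have hco' : IsCompact (C ∩ {x | 0 ≤ cr P Q x}) :=
    hco.of_isClosed_subset (half_closed hcl P Q) inter_subset_left
  have hne'' : (interior (C ∩ {x | 0 ≤ cr P Q x})).Nonempty := by
    rw [half_interior hne']
    have hm : (1/2 : ℝ) • P + (1/2 : ℝ) • Q ∈ openSegment ℝ P Q :=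
      ⟨1/2, 1/2, by norm_num, by norm_num, by norm_num, rfl⟩
    obtain ⟨y, hy, hlt⟩ := (exists_near hne' isOpen_interior (hintPQ hm)).1
    rw [cr_seg (openSegment_subset_segment ℝ _ _ hm)] at hlt
    exact ⟨y, hy, hlt⟩
  refine ⟨Fi, fun x hx => hFif x hx.2, ⟨g, fun x hx => hFiσ x hx, hgp, hgq⟩, hSLi, hinji,
    ⟨_, hC', hco', hne'', himi⟩, ?_⟩
  rintro hall c d ⟨⟨⟨hcd, t, ht, hc, hd⟩, hcf, hdf, hcdo⟩, x, hx, hcol⟩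
  rw [hpos₁] at hcf hdf hcdo hx hcol
  have vf : ∀ v ∈ vset t, D.pos v ∈ frontier D₁.space → D.pos v ∈ frontier D.space := by
    intro v hv hvf
    rcases f1 _ hvf with h | h
    · exact h
    · rcases mem_seg_cases h with h | h | h
      · exact h ▸ hpa
      · exact h ▸ hpb
      · exact absurd h (vertex_not_openSeg D (htris ht) ht₀ ha₀ hb₀ hab hv)
  have hcf' := vf c hc hcf
  have hdf' := vf d hd hdf
  have hX1X : D₁.space ⊆ D.space := by rw [← hsp]; exact subset_union_left
  have hspan : D.IsSpanningEdge c d :=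
    ⟨⟨hcd, t, htris ht, hc, hd⟩, hcf', hdf', hcdo.trans (interior_mono hX1X)⟩
  have hcdint := openSeg_int_of_not_obs D hSL hinj hC hco hne him hspan (hall c d)
  have hFc : Fi (D.pos c) = F (D.pos c) := hFif _ hcf'
  have hFd : Fi (D.pos d) = F (D.pos d) := hFif _ hdf'
  have hnot : ¬ openSegment ℝ (Fi (D.pos c)) (Fi (D.pos d)) ⊆
      interior (C ∩ {x | 0 ≤ cr P Q x}) := fun h =>
    not_obstr_of_interior (frontier_compact D₁) (SL_cont D₁ hSLi) hinji hC' hco' himi hcf hdf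
      (fun h => hcd (D.inj h)) h hx hcol
  apply hnot
  rw [hFc, hFd, half_interior hne']
  intro z hz
  refine ⟨hcdint hz, ?_⟩
  have hc0 : 0 ≤ cr P Q (F (D.pos c)) := by
    have : Fi (D.pos c) ∈ frontier (C ∩ {x | 0 ≤ cr P Q x}) := himi ▸ mem_image_of_mem Fi hcf
    rw [hFc] at this
    exact (hco'.isClosed.frontier_subset this).2
  have hd0 : 0 ≤ cr P Q (F (D.pos d)) := by
    have : Fi (D.pos d) ∈ frontier (C ∩ {x | 0 ≤ cr P Q x}) := himi ▸ mem_image_of_mem Fi hdf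
    rw [hFd] at this
    exact (hco'.isClosed.frontier_subset this).2
  obtain ⟨s, r, hs, hr, hsr, rfl⟩ := hz
  simp only [mem_ofPred_eq]
  rw [cr_combo _ _ _ _ _ _ hsr]
  by_contra hle
  push Not at hle
  have e1 := mul_nonneg hs.le hc0
  have e2 := mul_nonneg hr.le hd0
  have hcz : cr P Q (F (D.pos c)) = 0 :=
    (mul_eq_zero.1 (by linarith : s * cr P Q (F (D.pos c)) = 0)).resolve_left hs.ne'
  have hdz : cr P Q (F (D.pos d)) = 0 :=
    (mul_eq_zero.1 (by linarith : r * cr P Q (F (D.pos d)) = 0)).resolve_left hr.ne'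
  have hcs : D.pos c ∈ segment ℝ p q := by
    by_contra h; exact hcrne' _ hcf' h hcz
  have hds : D.pos d ∈ segment ℝ p q := by
    by_contra h; exact hcrne' _ hdf' h hdz
  have hmid : (1/2 : ℝ) • D.pos c + (1/2 : ℝ) • D.pos d ∈ openSegment ℝ (D.pos c) (D.pos d) :=
    ⟨1/2, 1/2, by norm_num, by norm_num, by norm_num, rfl⟩
  exact (f2 ((convex_segment p q).openSegment_subset hcs hds hmid)).2 (hcdo hmid)

end IndEmb

/-- **Property 1.** Let `σ = {a,b}` be a non-`F`-obstructive spanning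
edge dividing the triangulated 2-disk `K` into `K₁` and `K₂`, where `F` is an SL
embedding of `∂K` with convex image. Then for each `i`, the map `Fᵢ` given by `F` on
`∂Kᵢ ∩ ∂K` and affinely on `σ` is an SL embedding of `∂Kᵢ` with convex image;
moreover if `K` has no `F`-obstructive spanning edge then `Kᵢ` has no
`Fᵢ`-obstructive spanning edge. -/
theorem induced_embedding_on_pieces
    {ι : Type} [Fintype ι] [DecidableEq ι]
    (D D₁ D₂ : TriDisk ι) (a b : ι)
    (hσ : D.IsSpanningEdge a b)
    (hpos₁ : D₁.pos = D.pos) (hpos₂ : D₂.pos = D.pos)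
    (htris : D₁.tris ∪ D₂.tris = D.tris) (hdisj : D₁.tris ∩ D₂.tris = ∅)
    (hsp : D₁.space ∪ D₂.space = D.space)
    (hcap : D₁.space ∩ D₂.space = segment ℝ (D.pos a) (D.pos b))
    (F : ℝ × ℝ → ℝ × ℝ)
    (hSL : D.SLOnBoundary F)
    (hinj : Set.InjOn F (frontier D.space))
    (hconv : D.ConvexImage F)
    (hnotobs : ¬ D.Obstructive F a b) :
    ∀ Di : TriDisk ι, (Di = D₁ ∨ Di = D₂) →
      ∃ Fi : ℝ × ℝ → ℝ × ℝ,
        Set.EqOn Fi F (frontier Di.space ∩ frontier D.space) ∧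
        (∃ g : (ℝ × ℝ) →ᵃ[ℝ] (ℝ × ℝ),
          Set.EqOn Fi g (segment ℝ (D.pos a) (D.pos b)) ∧
          g (D.pos a) = F (D.pos a) ∧ g (D.pos b) = F (D.pos b)) ∧
        Di.SLOnBoundary Fi ∧
        Set.InjOn Fi (frontier Di.space) ∧
        Di.ConvexImage Fi ∧
        ((∀ c d : ι, ¬ D.Obstructive F c d) →
          ∀ c d : ι, ¬ Di.Obstructive Fi c d) := by
  intro Di hDi
  rcases hDi with rfl | rfl
  · exact IndEmb.piece_main D Di D₂ a b hσ hpos₁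
      (by rw [← htris]; exact Finset.subset_union_left) hsp hcap F hSL hinj hconv hnotobs
  · exact IndEmb.piece_main D Di D₁ a b hσ hpos₂
      (by rw [← htris]; exact Finset.subset_union_right) (by rw [Set.union_comm]; exact hsp)
      (by rw [Set.inter_comm]; exact hcap) F hSL hinj hconv hnotobs
end
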